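/- Let N ≥ 2 and p ∈ (1, p_N). For every λ ≥ 0 and every solution (α, ψ) of problem (P)_λ on the unit-volume ball 𝔻_N, every eigenvalue σ of the linearized operator L_λ at (α, ψ) is strictly positive (that is, σ_1(α, ψ) > 0, so λ_*(𝔻_N, p) = +∞). -/

import Mathlib

open MeasureTheory Metric Set

noncomputable section

/-- The Laplacian of a function on Euclidean space. -/
def lapl {N : ℕ} (f : EuclideanSpace ℝ (Fin N) → ℝ) (x : EuclideanSpace ℝ (Fin N)) : ℝ :=
  ∑ i : Fin N,
    fderiv ℝ (fun y => fderiv ℝ f y (EuclideanSpace.single i (1 : ℝ))) x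
      (EuclideanSpace.single i (1 : ℝ))

/-- `(α, ψ)` is a solution of problem `(P)_λ` on `Ω`:
`ψ ∈ C²`, `-Δψ = (max (α + λψ) 0)^p` in `Ω`, `ψ = 0` on `∂Ω`, and
`∫_Ω (max (α + λψ) 0)^p = 1`. -/
def IsSol {N : ℕ} (Ω : Set (EuclideanSpace ℝ (Fin N))) (p lam α : ℝ)
    (ψ : EuclideanSpace ℝ (Fin N) → ℝ) : Prop :=
  ContDiff ℝ 2 ψ ∧
  (∀ x ∈ Ω, -lapl ψ x = (max (α + lam * ψ x) 0) ^ p) ∧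
  (∀ x ∈ frontier Ω, ψ x = 0) ∧
  (∫ x in Ω, (max (α + lam * ψ x) 0) ^ p) = 1

/-- The radius `R_N` of the ball in `ℝ^N` centered at the origin with unit volume. -/
def RN (N : ℕ) : ℝ :=
  (volume (ball (0 : EuclideanSpace ℝ (Fin N)) 1)).toReal ^ (-(1 : ℝ) / (N : ℝ))

/-- `𝔻_N`: the open ball in `ℝ^N` centered at the origin with unit volume. -/
def DN (N : ℕ) : Set (EuclideanSpace ℝ (Fin N)) := ball 0 (RN N)

/-- The weight `V = (max (α + λψ) 0)^(p-1)`. -/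
def Vfun {N : ℕ} (p lam α : ℝ) (ψ : EuclideanSpace ℝ (Fin N) → ℝ)
    (x : EuclideanSpace ℝ (Fin N)) : ℝ :=
  (max (α + lam * ψ x) 0) ^ (p - 1)

/-- `m = ∫_Ω V`. -/
def mV {N : ℕ} (Ω : Set (EuclideanSpace ℝ (Fin N))) (p lam α : ℝ)
    (ψ : EuclideanSpace ℝ (Fin N) → ℝ) : ℝ :=
  ∫ x in Ω, Vfun p lam α ψ x

/-- The weighted average `⟨φ⟩ = (∫_Ω V φ) / m`. -/
def avgV {N : ℕ} (Ω : Set (EuclideanSpace ℝ (Fin N))) (p lam α : ℝ)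
    (ψ φ : EuclideanSpace ℝ (Fin N) → ℝ) : ℝ :=
  (∫ x in Ω, Vfun p lam α ψ x * φ x) / mV Ω p lam α ψ

/-- `σ` is an eigenvalue of the linearized operator `L_λ` at the solution `(α, ψ)`:
there is a nontrivial `φ ∈ C²(Ω̄)` vanishing on `∂Ω` with `-Δφ = (pλ + σ) V [φ]` in `Ω`. -/
def IsEigen {N : ℕ} (Ω : Set (EuclideanSpace ℝ (Fin N))) (p lam α : ℝ)
    (ψ : EuclideanSpace ℝ (Fin N) → ℝ) (σ : ℝ) : Prop :=
  ∃ φ : EuclideanSpace ℝ (Fin N) → ℝ, ContDiff ℝ 2 φ ∧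
    (∃ x ∈ closure Ω, φ x ≠ 0) ∧ (∀ x ∈ frontier Ω, φ x = 0) ∧
    ∀ x ∈ Ω, -lapl φ x = (p * lam + σ) * (Vfun p lam α ψ x * (φ x - avgV Ω p lam α ψ φ))

open Filter Topology

/-! ### Calculus of the Laplacian -/

section Laplacian

variable {N : ℕ} {f g : EuclideanSpace ℝ (Fin N) → ℝ} {x : EuclideanSpace ℝ (Fin N)}

lemma fderiv_fderiv_apply (hf : ContDiffAt ℝ 2 f x) (a b : EuclideanSpace ℝ (Fin N)) :
    fderiv ℝ (fun y => fderiv ℝ f y a) x b = fderiv ℝ (fderiv ℝ f) x b a := by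
  have h : DifferentiableAt ℝ (fderiv ℝ f) x :=
    (hf.fderiv_right (m := 1) (by norm_num)).differentiableAt (by norm_num)
  rw [fderiv_clm_apply h (differentiableAt_const a)]
  simp

lemma fderiv_fderiv_comm (hf : ContDiffAt ℝ 2 f x) (a b : EuclideanSpace ℝ (Fin N)) :
    fderiv ℝ (fun y => fderiv ℝ f y a) x b = fderiv ℝ (fun y => fderiv ℝ f y b) x a := by
  rw [fderiv_fderiv_apply hf, fderiv_fderiv_apply hf]
  exact (hf.isSymmSndFDerivAt (by simp)) b a

lemma lapl_eq_laplacian (hf : ContDiffAt ℝ 2 f x) :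
    lapl f x = Laplacian.laplacian f x := by
  rw [InnerProductSpace.laplacian_eq_iteratedFDeriv_orthonormalBasis f
    (EuclideanSpace.basisFun (Fin N) ℝ)]
  simp [lapl, fderiv_fderiv_apply hf, iteratedFDeriv_two_apply]

lemma lapl_sub (hf : ContDiffAt ℝ 2 f x) (hg : ContDiffAt ℝ 2 g x) :
    lapl (fun y => f y - g y) x = lapl f x - lapl g x := by
  rw [lapl_eq_laplacian hf, lapl_eq_laplacian hg, lapl_eq_laplacian (hf.sub hg)]
  exact hf.laplacian_sub hg

lemma lapl_const_mul (c : ℝ) (hf : ContDiffAt ℝ 2 f x) :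
    lapl (fun y => c * f y) x = c * lapl f x := by
  rw [lapl_eq_laplacian hf, lapl_eq_laplacian (contDiffAt_const.mul hf)]
  exact InnerProductSpace.laplacian_smul (𝕜 := ℝ) c hf

lemma lapl_neg (hf : ContDiffAt ℝ 2 f x) : lapl (fun y => -f y) x = -lapl f x := by
  simpa using lapl_const_mul (-1) hf

lemma lapl_congr (h : f =ᶠ[𝓝 x] g) : lapl f x = lapl g x := by
  unfold lapl
  congr 1; ext i
  have : (fun y => fderiv ℝ f y (EuclideanSpace.single i (1 : ℝ))) =ᶠ[𝓝 x]
      fun y => fderiv ℝ g y (EuclideanSpace.single i (1 : ℝ)) := by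
    filter_upwards [h.fderiv (𝕜 := ℝ)] with y hy
    rw [hy]
  rw [this.fderiv_eq]

/-- The Laplacian is invariant under affine isometries. -/
lemma lapl_comp_isometry (hf : ContDiff ℝ 2 f)
    (L : EuclideanSpace ℝ (Fin N) ≃ₗᵢ[ℝ] EuclideanSpace ℝ (Fin N))
    (c x : EuclideanSpace ℝ (Fin N)) :
    lapl (fun y => f (L y + c)) x = lapl f (L x + c) := by
  have hL : ContDiff ℝ 2 L := L.toContinuousLinearEquiv.contDiff
  have hfL : ContDiff ℝ 2 (fun y => f (L y + c)) := hf.comp (hL.add contDiff_const)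
  rw [lapl_eq_laplacian hfL.contDiffAt,
    lapl_eq_laplacian hf.contDiffAt,
    InnerProductSpace.laplacian_eq_iteratedFDeriv_orthonormalBasis _
      (EuclideanSpace.basisFun (Fin N) ℝ),
    InnerProductSpace.laplacian_eq_iteratedFDeriv_orthonormalBasis f
      ((EuclideanSpace.basisFun (Fin N) ℝ).map L)]
  have h1 : (fun y => f (L y + c)) = (fun z => f (z + c)) ∘ L.toContinuousLinearEquiv := rfl
  simp only [h1]
  congr 1; ext i
  have hfc : ContDiff ℝ 2 (fun z => f (z + c)) := hf.comp (contDiff_id.add contDiff_const)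
  have := L.toContinuousLinearEquiv.toContinuousLinearMap.iteratedFDeriv_comp_right hfc x
    (i := 2) le_rfl
  erw [this]
  rw [ContinuousMultilinearMap.compContinuousLinearMap_apply,
    iteratedFDeriv_comp_add_right]
  congr 1
  ext j
  fin_cases j <;> rfl

lemma lapl_nonneg_of_isLocalMin (hf : ContDiffAt ℝ 2 f x) (hmin : IsLocalMin f x) :
    0 ≤ lapl f x := by
  refine Finset.sum_nonneg fun i _ => ?_
  set e := EuclideanSpace.single i (1 : ℝ)
  by_contra! hneg
  have hline : ∀ t : ℝ, HasDerivAt (fun t : ℝ => x + t • e) e t := fun t => by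
    simpa using ((hasDerivAt_id t).smul_const e).const_add x
  have hcont : Tendsto (fun t : ℝ => x + t • e) (𝓝 0) (𝓝 x) := by
    simpa using (hline 0).continuousAt.tendsto
  have hd : ∀ᶠ t in 𝓝 (0 : ℝ), deriv (fun t : ℝ => f (x + t • e)) t =
      fderiv ℝ f (x + t • e) e := by
    have : ∀ᶠ y in 𝓝 x, DifferentiableAt ℝ f y :=
      (hf.eventually (by simp)).mono fun y hy => hy.differentiableAt (by norm_num)
    filter_upwards [hcont.eventually this] with t ht
    exact (ht.hasFDerivAt.comp_hasDerivAt t (hline t)).deriv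
  have hdd : deriv (deriv (fun t : ℝ => f (x + t • e))) 0 =
      fderiv ℝ (fun y => fderiv ℝ f y e) x e := by
    rw [EventuallyEq.deriv_eq hd]
    have h1 : DifferentiableAt ℝ (fun y => fderiv ℝ f y e) x :=
      ((hf.fderiv_right (m := 1) (by norm_num)).differentiableAt (by norm_num)).clm_apply
        (differentiableAt_const e)
    have h2 : HasFDerivAt (fun y => fderiv ℝ f y e)
        (fderiv ℝ (fun y => fderiv ℝ f y e) x) (x + (0 : ℝ) • e) := by
      simpa using h1.hasFDerivAt
    exact (h2.comp_hasDerivAt 0 (hline 0)).deriv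
  have hc : ContinuousAt (fun t : ℝ => f (x + t • e)) 0 := by
    have h1 : ContinuousAt f (x + (0 : ℝ) • e) := by simpa using hf.continuousAt
    exact ContinuousAt.comp (f := fun t : ℝ => x + t • e) h1 (hline 0).continuousAt
  have hmin' : IsLocalMin (fun t : ℝ => f (x + t • e)) 0 := by
    filter_upwards [hcont.eventually hmin] with t ht
    simpa using ht
  have hmax := isLocalMax_of_deriv_deriv_neg (hdd ▸ hneg) hmin'.deriv_eq_zero hc
  have hconst : (fun t : ℝ => f (x + t • e)) =ᶠ[𝓝 0] fun _ => f (x + (0 : ℝ) • e) := by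
    filter_upwards [hmin', hmax] with t h1 h2
    exact le_antisymm h2 h1
  have h0 : deriv (deriv (fun t : ℝ => f (x + t • e))) 0 = 0 := by
    rw [hconst.deriv.deriv_eq]
    simp
  rw [hdd] at h0
  exact hneg.ne h0

/-- The Laplacian of a function of `‖y - c‖ ^ 2`. -/
lemma lapl_comp_norm_sq {G G' : ℝ → ℝ} {G'' : ℝ} (c x : EuclideanSpace ℝ (Fin N))
    (hG : ∀ᶠ s in 𝓝 (‖x - c‖ ^ 2), HasDerivAt G (G' s) s)
    (hG' : HasDerivAt G' G'' (‖x - c‖ ^ 2)) :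
    lapl (fun y => G (‖y - c‖ ^ 2)) x =
      2 * N * G' (‖x - c‖ ^ 2) + 4 * ‖x - c‖ ^ 2 * G'' := by
  have hn : ∀ y : EuclideanSpace ℝ (Fin N), HasFDerivAt (fun y => ‖y - c‖ ^ 2)
      (2 • (innerSL ℝ (y - c))) y := fun y => by
    refine ((hasFDerivAt_id y).sub_const c).norm_sq.congr_fderiv ?_
    ext v; simp
  have hcont : Tendsto (fun y : EuclideanSpace ℝ (Fin N) => ‖y - c‖ ^ 2) (𝓝 x)
      (𝓝 (‖x - c‖ ^ 2)) := (hn x).continuousAt.tendsto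
  have hterm : ∀ i : Fin N, fderiv ℝ (fun y => fderiv ℝ (fun y => G (‖y - c‖ ^ 2)) y
      (EuclideanSpace.single i (1 : ℝ))) x (EuclideanSpace.single i (1 : ℝ)) =
      2 * G' (‖x - c‖ ^ 2) + 4 * G'' * ((x - c) i) ^ 2 := by
    intro i
    have h1 : (fun y => fderiv ℝ (fun y => G (‖y - c‖ ^ 2)) y
        (EuclideanSpace.single i (1 : ℝ))) =ᶠ[𝓝 x]
        fun y => G' (‖y - c‖ ^ 2) * (2 * (y i - c i)) := by
      filter_upwards [hcont.eventually hG] with y hy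
      have h := hy.comp_hasFDerivAt y (hn y)
      rw [show (fun y => G (‖y - c‖ ^ 2)) = G ∘ fun y => ‖y - c‖ ^ 2 from rfl, h.fderiv]
      simp [EuclideanSpace.inner_single_right]
    rw [h1.fderiv_eq]
    have h2 : HasFDerivAt (fun y : EuclideanSpace ℝ (Fin N) => 2 * (y i - c i))
        ((2 : ℝ) • (EuclideanSpace.proj i : EuclideanSpace ℝ (Fin N) →L[ℝ] ℝ)) x := by
      have := ((EuclideanSpace.proj i : EuclideanSpace ℝ (Fin N) →L[ℝ] ℝ).hasFDerivAt
        (x := x)).sub_const (c i) |>.const_mul 2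
      exact this
    have h3 := (hG'.comp_hasFDerivAt x (hn x)).mul h2
    rw [show (fun y : EuclideanSpace ℝ (Fin N) => G' (‖y - c‖ ^ 2) * (2 * (y i - c i))) =
      (G' ∘ fun y => ‖y - c‖ ^ 2) * fun y => 2 * (y i - c i) from rfl, h3.fderiv]
    simp [EuclideanSpace.inner_single_right]
    ring
  unfold lapl
  have hsum : ∑ i : Fin N, ((x - c) i) ^ 2 = ‖x - c‖ ^ 2 := by
    rw [EuclideanSpace.norm_sq_eq]; simp
  rw [Finset.sum_congr rfl fun i _ => hterm i, Finset.sum_add_distrib,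
    ← Finset.mul_sum (f := fun i => (x - c) i ^ 2), hsum]
  simp
  ring

/-- The Laplacian of a radial function away from the origin. -/
lemma lapl_radial {U U' : ℝ → ℝ} {U'' : ℝ} {x : EuclideanSpace ℝ (Fin N)} (hx : x ≠ 0)
    (hU : ∀ᶠ r in 𝓝 ‖x‖, HasDerivAt U (U' r) r) (hU' : HasDerivAt U' U'' ‖x‖) :
    lapl (fun y => U ‖y‖) x = U'' + (N - 1) * (U' ‖x‖ / ‖x‖) := by
  have hr : 0 < ‖x‖ := norm_pos_iff.2 hx
  have hs : √(‖x‖ ^ 2) = ‖x‖ := Real.sqrt_sq hr.le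
  have hsq : ∀ᶠ s in 𝓝 (‖x‖ ^ 2), HasDerivAt (fun s => U √s) (U' √s * (1 / (2 * √s))) s := by
    have h1 : Tendsto (fun s : ℝ => √s) (𝓝 (‖x‖ ^ 2)) (𝓝 ‖x‖) := by
      have := Real.continuous_sqrt.tendsto (‖x‖ ^ 2)
      rwa [hs] at this
    filter_upwards [h1.eventually hU, lt_mem_nhds (by positivity : 0 < ‖x‖ ^ 2)] with s h2 h3
    exact h2.comp s (Real.hasDerivAt_sqrt h3.ne')
  have h4 : HasDerivAt (fun s => U' √s * (1 / (2 * √s)))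
      (U'' * (1 / (2 * ‖x‖)) * (1 / (2 * ‖x‖)) +
        U' ‖x‖ * (-(1 / ‖x‖) / (2 * ‖x‖) ^ 2)) (‖x‖ ^ 2) := by
    have h5 : HasDerivAt (fun s => √s) (1 / (2 * ‖x‖)) (‖x‖ ^ 2) := by
      have := Real.hasDerivAt_sqrt (by positivity : ‖x‖ ^ 2 ≠ 0)
      rwa [hs] at this
    have h6 : HasDerivAt (fun s => U' √s) (U'' * (1 / (2 * ‖x‖))) (‖x‖ ^ 2) :=
      HasDerivAt.comp (h₂ := U') (‖x‖ ^ 2) (by rwa [hs]) h5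
    have h7 : HasDerivAt (fun s => 1 / (2 * √s)) (-(1 / ‖x‖) / (2 * ‖x‖) ^ 2) (‖x‖ ^ 2) := by
      have := (h5.const_mul 2).inv (by rw [hs]; positivity)
      simp only [one_div (2 * √_)]
      refine this.congr_deriv ?_
      rw [hs]; field_simp
    have := h6.mul h7
    rwa [hs] at this
  have key := lapl_comp_norm_sq (N := N) (G := fun s => U √s)
    (G' := fun s => U' √s * (1 / (2 * √s))) 0 x (by simpa using hsq) (by simpa using h4)
  simp only [sub_zero, Real.sqrt_sq (norm_nonneg _)] at key
  rw [key]
  field_simp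
  ring

/-- Directional derivatives commute with the Laplacian. -/
lemma lapl_fderiv_apply (hf : ContDiffAt ℝ 3 f x) (e : EuclideanSpace ℝ (Fin N)) :
    lapl (fun y => fderiv ℝ f y e) x = fderiv ℝ (lapl f) x e := by
  have hf2 : ∀ᶠ y in 𝓝 x, ContDiffAt ℝ 2 f y :=
    (hf.eventually (by simp)).mono fun y hy => hy.of_le (by norm_num)
  have hd : ∀ a : EuclideanSpace ℝ (Fin N), ContDiffAt ℝ 2 (fun y => fderiv ℝ f y a) x :=
    fun a => (hf.fderiv_right (m := 2) (by norm_num)).clm_apply contDiffAt_const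
  have hdd : ∀ a b : EuclideanSpace ℝ (Fin N),
      DifferentiableAt ℝ (fun y => fderiv ℝ (fun z => fderiv ℝ f z a) y b) x := fun a b =>
    (((hd a).fderiv_right (m := 1) (by norm_num)).clm_apply contDiffAt_const).differentiableAt
      (by norm_num)
  have : lapl f = fun y => ∑ i : Fin N, fderiv ℝ (fun z => fderiv ℝ f z
      (EuclideanSpace.single i (1 : ℝ))) y (EuclideanSpace.single i (1 : ℝ)) := rfl
  rw [this, fderiv_fun_sum fun i _ => hdd _ _, _root_.sum_apply]
  unfold lapl
  congr 1; ext i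
  have h1 : (fun y => fderiv ℝ (fun z => fderiv ℝ f z e) y (EuclideanSpace.single i (1 : ℝ)))
      =ᶠ[𝓝 x] fun y => fderiv ℝ (fun z => fderiv ℝ f z (EuclideanSpace.single i (1 : ℝ))) y e := by
    filter_upwards [hf2] with y hy using fderiv_fderiv_comm hy _ _
  rw [h1.fderiv_eq]
  exact fderiv_fderiv_comm (hd _) _ _

end Laplacian

/-! ### Maximum principles -/

section MaximumPrinciple

lemma HasDerivAt.nonneg_of_eventually_nonneg {φ : ℝ → ℝ} {φ' : ℝ} (h : HasDerivAt φ φ' 0)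
    (h0 : φ 0 = 0) (hpos : ∀ᶠ t in 𝓝[>] (0 : ℝ), 0 ≤ φ t) : 0 ≤ φ' := by
  have h1 := (hasDerivAt_iff_tendsto_slope.1 h).mono_left
    (nhdsWithin_mono 0 (fun x (hx : 0 < x) => hx.ne') : 𝓝[>] (0 : ℝ) ≤ 𝓝[≠] 0)
  refine ge_of_tendsto h1 ?_
  filter_upwards [hpos, self_mem_nhdsWithin] with t ht ht0
  rw [slope_def_field, h0, sub_zero, sub_zero]
  exact div_nonneg ht (le_of_lt ht0)

variable {N : ℕ}

/-- Weak minimum principle. -/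
lemma nonneg_of_lapl_nonpos (hN : 0 < N) {Ω : Set (EuclideanSpace ℝ (Fin N))}
    (hb : Bornology.IsBounded Ω) (ho : IsOpen Ω) {w : EuclideanSpace ℝ (Fin N) → ℝ}
    (hc : Continuous w) (hd : ∀ x ∈ Ω, ContDiffAt ℝ 2 w x)
    (hl : ∀ x ∈ Ω, w x < 0 → lapl w x ≤ 0) (hf : ∀ x ∈ frontier Ω, 0 ≤ w x) :
    ∀ x ∈ Ω, 0 ≤ w x := by
  intro x₀ hx₀
  by_contra! hneg
  obtain ⟨M, hM⟩ := hb.closure.exists_norm_le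
  have hK : IsCompact (closure Ω) := hb.isCompact_closure
  have hM0 : 0 ≤ M := (norm_nonneg _).trans (hM x₀ (subset_closure hx₀))
  set ε := -w x₀ / (2 * (M ^ 2 + 1)) with hε
  have hεpos : 0 < ε := by have : 0 < -w x₀ := by linarith
                           positivity
  have hεM : ε * M ^ 2 < -w x₀ := by
    rw [hε, div_mul_eq_mul_div, div_lt_iff₀ (by positivity)]
    nlinarith [sq_nonneg M]
  obtain ⟨x₁, hx₁, hmin⟩ := hK.exists_isMinOn ⟨x₀, subset_closure hx₀⟩
    (f := fun x => w x - ε * ‖x - 0‖ ^ 2) (by fun_prop)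
  have h01 : w x₁ - ε * ‖x₁ - 0‖ ^ 2 ≤ w x₀ - ε * ‖x₀ - 0‖ ^ 2 := hmin (subset_closure hx₀)
  have hw1 : w x₁ < 0 := by
    have h2 : ‖x₁‖ ^ 2 ≤ M ^ 2 := pow_le_pow_left₀ (norm_nonneg _) (hM x₁ hx₁) 2
    have h3 : 0 ≤ ε * ‖x₀ - 0‖ ^ 2 := by positivity
    rw [sub_zero x₁] at h01
    nlinarith
  have hx₁Ω : x₁ ∈ Ω := by
    by_contra hcon
    have : x₁ ∈ frontier Ω := ⟨hx₁, by rwa [ho.interior_eq]⟩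
    exact absurd (hf x₁ this) (not_le.2 hw1)
  have hsq : ContDiff ℝ 2 (fun x : EuclideanSpace ℝ (Fin N) => ‖x - 0‖ ^ 2) :=
    (contDiff_id.sub contDiff_const).norm_sq ℝ
  have hloc : IsLocalMin (fun x => w x - ε * ‖x - 0‖ ^ 2) x₁ :=
    (hmin.on_subset subset_closure).isLocalMin (ho.mem_nhds hx₁Ω)
  have hnn := lapl_nonneg_of_isLocalMin
    ((hd x₁ hx₁Ω).sub (contDiffAt_const.mul hsq.contDiffAt)) hloc
  have hq : lapl (fun x : EuclideanSpace ℝ (Fin N) => ‖x - 0‖ ^ 2) x₁ = 2 * N := by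
    have := lapl_comp_norm_sq (G := fun s => s) (G' := fun _ => 1) (G'' := 0) 0 x₁
      (Eventually.of_forall fun s => hasDerivAt_id s) (hasDerivAt_const _ _)
    simpa using this
  rw [lapl_sub (hd x₁ hx₁Ω) (contDiffAt_const.mul hsq.contDiffAt),
    lapl_const_mul _ hsq.contDiffAt, hq] at hnn
  have := hl x₁ hx₁Ω hw1
  have hNpos : (0 : ℝ) < N := by exact_mod_cast hN
  have : 0 < ε * (2 * N) := by positivity
  linarith

/-- Hopf's boundary point lemma on a ball. -/
lemma hopf_ball (hN : 0 < N) {y x₀ : EuclideanSpace ℝ (Fin N)} {ρ : ℝ} (hρ : 0 < ρ)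
    {w : EuclideanSpace ℝ (Fin N) → ℝ} (hc : Continuous w)
    (hd : ∀ x ∈ ball y ρ, ContDiffAt ℝ 2 w x) (hl : ∀ x ∈ ball y ρ, lapl w x ≤ 0)
    (hpos : ∀ x ∈ ball y ρ, 0 < w x) (hx₀ : x₀ ∈ sphere y ρ) (hw0 : w x₀ = 0)
    (hdx : DifferentiableAt ℝ w x₀) : 0 < fderiv ℝ w x₀ (y - x₀) := by
  have hNpos : (0 : ℝ) < N := by exact_mod_cast hN
  set a : ℝ := 2 * N / ρ ^ 2 with ha
  have ha0 : 0 < a := by positivity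
  have haρ : a * ρ ^ 2 = 2 * N := by rw [ha]; field_simp
  set G : ℝ → ℝ := fun s => Real.exp (-a * s) with hG
  set h : EuclideanSpace ℝ (Fin N) → ℝ := fun x => G (‖x - y‖ ^ 2) - Real.exp (-a * ρ ^ 2) with hh
  have hGd : ContDiff ℝ 2 fun x : EuclideanSpace ℝ (Fin N) => G (‖x - y‖ ^ 2) :=
    (contDiff_const.mul ((contDiff_id.sub contDiff_const).norm_sq ℝ)).exp
  have hhd : ContDiff ℝ 2 h := hGd.sub contDiff_const
  have hG1 : ∀ s, HasDerivAt G (-a * G s) s := fun s => by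
    have := ((hasDerivAt_id s).const_mul (-a)).exp
    refine this.congr_deriv ?_
    simp [hG]; ring
  have hlh : ∀ x, lapl h x = (4 * a ^ 2 * ‖x - y‖ ^ 2 - 2 * N * a) * G (‖x - y‖ ^ 2) := by
    intro x
    have h1 := lapl_comp_norm_sq (G := G) (G' := fun s => -a * G s) (G'' := -a * (-a * G _)) y x
      (Eventually.of_forall hG1) ((hG1 _).const_mul (-a))
    have h2 : lapl h x = lapl (fun x => G (‖x - y‖ ^ 2)) x := by
      rw [hh, lapl_sub hGd.contDiffAt contDiffAt_const]
      simp [lapl]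
    rw [h2, h1]; ring
  have hS : IsCompact (sphere y (ρ / 2)) := isCompact_sphere _ _
  have hSsub : sphere y (ρ / 2) ⊆ ball y ρ := fun x hx => by
    rw [mem_sphere] at hx; rw [mem_ball, hx]; linarith
  have : Nontrivial (EuclideanSpace ℝ (Fin N)) := by
    have : Nonempty (Fin N) := ⟨⟨0, hN⟩⟩
    infer_instance
  have hSne : (sphere y (ρ / 2)).Nonempty := NormedSpace.sphere_nonempty.2 (by linarith)
  obtain ⟨z, hz, hzmin⟩ := hS.exists_isMinOn hSne hc.continuousOn
  set ε := w z with hε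
  have hε0 : 0 < ε := hpos z (hSsub hz)
  set Ω := ball y ρ \ closedBall y (ρ / 2) with hΩ
  have hΩo : IsOpen Ω := isOpen_ball.sdiff isClosed_closedBall
  have hΩb : Bornology.IsBounded Ω := isBounded_ball.subset sdiff_subset
  have hhle : ∀ x, h x ≤ 1 := fun x => by
    have h1 : G (‖x - y‖ ^ 2) ≤ 1 := by
      rw [hG]; apply Real.exp_le_one_iff.2; nlinarith [sq_nonneg ‖x - y‖]
    have h2 := Real.exp_pos (-a * ρ ^ 2)
    simp only [hh]; linarith
  have hcomp : ∀ x ∈ Ω, 0 ≤ w x - ε * h x := by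
    refine nonneg_of_lapl_nonpos hN hΩb hΩo (hc.sub (continuous_const.mul hhd.continuous))
      (fun x hx => (hd x hx.1).sub (contDiffAt_const.mul hhd.contDiffAt)) ?_ ?_
    · intro x hx _
      rw [lapl_sub (hd x hx.1) (contDiffAt_const.mul hhd.contDiffAt),
        lapl_const_mul _ hhd.contDiffAt, hlh]
      have h1 := hl x hx.1
      have h2 : ρ / 2 < ‖x - y‖ := by
        have := hx.2
        rwa [mem_closedBall, not_le, dist_eq_norm] at this
      have h3 : (ρ / 2) ^ 2 ≤ ‖x - y‖ ^ 2 := pow_le_pow_left₀ (by positivity) h2.le 2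
      have h4 : 0 ≤ 4 * a ^ 2 * ‖x - y‖ ^ 2 - 2 * N * a := by
        rw [← haρ]
        have : 0 ≤ a ^ 2 * (‖x - y‖ ^ 2 - (ρ / 2) ^ 2) :=
          mul_nonneg (sq_nonneg _) (by linarith)
        nlinarith
      have h5 : 0 < G (‖x - y‖ ^ 2) := Real.exp_pos _
      have : 0 ≤ ε * ((4 * a ^ 2 * ‖x - y‖ ^ 2 - 2 * N * a) * G (‖x - y‖ ^ 2)) := by positivity
      linarith
    · intro x hx
      rw [hΩo.frontier_eq] at hx
      have hxc : x ∈ closedBall y ρ :=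
        closure_minimal (sdiff_subset.trans ball_subset_closedBall) isClosed_closedBall hx.1
      have hx2 : ρ / 2 ≤ dist x y := by
        have : closure Ω ⊆ {x | ρ / 2 ≤ dist x y} := by
          refine closure_minimal (fun z hz => ?_)
            (isClosed_le continuous_const (continuous_id.dist continuous_const))
          have := hz.2
          rw [mem_closedBall, not_le] at this
          exact this.le
        exact this hx.1
      rcases eq_or_lt_of_le (mem_closedBall.1 hxc) with h1 | h1
      · have hw : 0 ≤ w x := by
          have : x ∈ closure (ball y ρ) := by
            rw [closure_ball y hρ.ne']; exact hxc
          exact closure_minimal (fun z hz => (hpos z hz).le)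
            (isClosed_le continuous_const hc) this
        have : h x = 0 := by
          simp only [hh, hG, ← dist_eq_norm, h1, sub_self]
        rw [this]; linarith
      · have h2 : dist x y = ρ / 2 := by
          refine le_antisymm ?_ hx2
          by_contra! hlt
          exact hx.2 ⟨mem_ball.2 h1, by simpa using hlt⟩
        have h3 : ε ≤ w x := hzmin (mem_sphere.2 h2)
        nlinarith [hhle x]
  have hline : HasDerivAt (fun t : ℝ => x₀ + t • (y - x₀)) (y - x₀) 0 := by
    simpa using ((hasDerivAt_id (0 : ℝ)).smul_const (y - x₀)).const_add x₀
  have hnorm : ∀ t : ℝ, ‖x₀ + t • (y - x₀) - y‖ ^ 2 = (1 - t) ^ 2 * ρ ^ 2 := by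
    intro t
    have : x₀ + t • (y - x₀) - y = (1 - t) • (x₀ - y) := by module
    rw [this, norm_smul, mul_pow, Real.norm_eq_abs, sq_abs, ← dist_eq_norm, mem_sphere.1 hx₀]
  have hder : HasDerivAt (fun t : ℝ => w (x₀ + t • (y - x₀)) - ε * h (x₀ + t • (y - x₀)))
      (fderiv ℝ w x₀ (y - x₀) - ε * (2 * a * ρ ^ 2 * Real.exp (-a * ρ ^ 2))) 0 := by
    have h1 : HasDerivAt (fun t : ℝ => w (x₀ + t • (y - x₀))) (fderiv ℝ w x₀ (y - x₀)) 0 := by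
      have h2 : HasFDerivAt w (fderiv ℝ w x₀) (x₀ + (0 : ℝ) • (y - x₀)) := by
        simpa using hdx.hasFDerivAt
      exact h2.comp_hasDerivAt 0 hline
    have h3 : HasDerivAt (fun t : ℝ => h (x₀ + t • (y - x₀)))
        (2 * a * ρ ^ 2 * Real.exp (-a * ρ ^ 2)) 0 := by
      simp only [hh, hnorm]
      have h4 : HasDerivAt (fun t : ℝ => (1 - t) ^ 2 * ρ ^ 2) (-2 * ρ ^ 2) 0 := by
        have := (((hasDerivAt_id (0 : ℝ)).const_sub 1).pow 2).mul_const (ρ ^ 2)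
        refine this.congr_deriv ?_
        simp
      have h5 := ((hG1 ((1 - (0 : ℝ)) ^ 2 * ρ ^ 2)).comp 0 h4).sub_const (Real.exp (-a * ρ ^ 2))
      refine h5.congr_deriv ?_
      simp only [hG, sub_zero, one_pow, one_mul]; ring
    exact h1.sub (h3.const_mul ε)
  have hfin := hder.nonneg_of_eventually_nonneg (by
    have h1 : h x₀ = 0 := by
      simp only [hh, hG, ← dist_eq_norm, mem_sphere.1 hx₀, sub_self]
    simp [hw0, h1]) (by
    have : Ioo (0 : ℝ) (1 / 2) ∈ 𝓝[>] (0 : ℝ) := Ioo_mem_nhdsGT (by norm_num)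
    filter_upwards [this] with t ht
    refine hcomp _ ⟨?_, ?_⟩
    · rw [mem_ball, dist_eq_norm]
      refine lt_of_pow_lt_pow_left₀ 2 hρ.le ?_
      rw [hnorm]
      have : (1 - t) ^ 2 < 1 := by nlinarith [ht.1, ht.2]
      have h2 : 0 < ρ ^ 2 := by positivity
      nlinarith
    · rw [mem_closedBall, dist_eq_norm, not_le]
      refine lt_of_pow_lt_pow_left₀ 2 (norm_nonneg _) ?_
      rw [hnorm]
      have : 1 / 4 < (1 - t) ^ 2 := by nlinarith [ht.1, ht.2]
      have h2 : 0 < ρ ^ 2 := by positivity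
      nlinarith)
  have : 0 < ε * (2 * a * ρ ^ 2 * Real.exp (-a * ρ ^ 2)) := by positivity
  linarith

/-- Strong minimum principle. -/
lemma pos_of_lapl_nonpos (hN : 0 < N) {Ω : Set (EuclideanSpace ℝ (Fin N))}
    (ho : IsOpen Ω) (hconn : IsPreconnected Ω) {w : EuclideanSpace ℝ (Fin N) → ℝ}
    (hc : Continuous w) (hd : ∀ x ∈ Ω, ContDiffAt ℝ 2 w x)
    (hl : ∀ x ∈ Ω, lapl w x ≤ 0) (hnn : ∀ x ∈ Ω, 0 ≤ w x) (hex : ∃ x ∈ Ω, 0 < w x) :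
    ∀ x ∈ Ω, 0 < w x := by
  have hUo : IsOpen {x | 0 < w x} := isOpen_lt continuous_const hc
  obtain ⟨x₁, hx₁, hw₁⟩ := hex
  refine hconn.subset_of_closure_inter_subset hUo ⟨x₁, hx₁, hw₁⟩ ?_
  intro z hz
  obtain hzc := hz.1
  obtain hzΩ := hz.2
  by_contra hz0
  have hwz : w z = 0 := le_antisymm (not_lt.1 hz0) (hnn z hzΩ)
  obtain ⟨r, hr, hrΩ⟩ := Metric.isOpen_iff.1 ho z hzΩ
  obtain ⟨y, hy, hyz⟩ := Metric.mem_closure_iff.1 hzc (r / 2) (by positivity)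
  have hZ : IsClosed {x | w x ≤ 0} := isClosed_le hc continuous_const
  obtain ⟨x₀, hx₀, hdist⟩ := hZ.exists_infDist_eq_dist ⟨z, hwz.le⟩ y
  set ρ := infDist y {x | w x ≤ 0} with hρ
  have hρr : ρ < r / 2 := by
    have h1 : ρ ≤ dist y z := infDist_le_dist_of_mem (show z ∈ {x | w x ≤ 0} from hwz.le)
    rw [dist_comm] at h1
    exact h1.trans_lt hyz
  have hρ0 : 0 < ρ := by
    rw [hdist]
    refine dist_pos.2 fun h => ?_
    rw [← h] at hx₀
    exact (not_le.2 (show 0 < w y from hy)) hx₀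
  have hsub : closedBall y ρ ⊆ Ω := fun x hx => hrΩ (by
    rw [mem_ball]
    have := dist_triangle x y z
    rw [mem_closedBall] at hx
    rw [dist_comm z y] at hyz
    linarith)
  have hx₀s : x₀ ∈ sphere y ρ := by rw [mem_sphere, dist_comm, hdist]
  have hx₀Ω : x₀ ∈ Ω := hsub (sphere_subset_closedBall hx₀s)
  have hw0 : w x₀ = 0 := le_antisymm hx₀ (hnn _ hx₀Ω)
  have hlt := hopf_ball hN hρ0 hc (fun x hx => hd x (hsub (ball_subset_closedBall hx)))
    (fun x hx => hl x (hsub (ball_subset_closedBall hx)))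
    (fun x hx => by
      by_contra hcon
      have : ρ ≤ dist y x :=
        infDist_le_dist_of_mem (show x ∈ {x | w x ≤ 0} from not_lt.1 hcon)
      rw [mem_ball, dist_comm] at hx
      linarith) hx₀s hw0 ((hd x₀ hx₀Ω).differentiableAt (by norm_num))
  have hmin : IsLocalMin w x₀ := by
    filter_upwards [ho.mem_nhds hx₀Ω] with x hx
    rw [hw0]; exact hnn x hx
  rw [hmin.fderiv_eq_zero] at hlt
  simp at hlt

end MaximumPrinciple

/-! ### Reflections and moving planes -/

section MovingPlanes

variable {N : ℕ}

/-- The reflection across the hyperplane `⟪x, e⟫ = t`, for a unit vector `e`. -/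
def planeRefl (e : EuclideanSpace ℝ (Fin N)) (t : ℝ) (x : EuclideanSpace ℝ (Fin N)) :
    EuclideanSpace ℝ (Fin N) :=
  x + (2 * (t - inner ℝ x e)) • e

variable {e : EuclideanSpace ℝ (Fin N)}

lemma planeRefl_eq (he : ‖e‖ = 1) (t : ℝ) (x : EuclideanSpace ℝ (Fin N)) :
    planeRefl e t x = (ℝ ∙ e)ᗮ.reflection x + (2 * t) • e := by
  rw [Submodule.reflection_orthogonal_apply, Submodule.reflection_singleton_apply, he, planeRefl,
    real_inner_comm]
  simp only [RCLike.ofReal_real_eq_id, id]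
  module

lemma inner_planeRefl (he : ‖e‖ = 1) (t : ℝ) (x : EuclideanSpace ℝ (Fin N)) :
    inner ℝ (planeRefl e t x) e = 2 * t - inner ℝ x e := by
  rw [planeRefl, inner_add_left, real_inner_smul_left, real_inner_self_eq_norm_sq, he]
  ring

lemma norm_sq_planeRefl (he : ‖e‖ = 1) (t : ℝ) (x : EuclideanSpace ℝ (Fin N)) :
    ‖planeRefl e t x‖ ^ 2 = ‖x‖ ^ 2 + 4 * t * (t - inner ℝ x e) := by
  rw [planeRefl, norm_add_sq_real, real_inner_smul_right, norm_smul, he, mul_one,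
    Real.norm_eq_abs, sq_abs]
  ring

lemma planeRefl_of_inner_eq {t : ℝ} {x : EuclideanSpace ℝ (Fin N)} (h : inner ℝ x e = t) :
    planeRefl e t x = x := by
  simp [planeRefl, h]

lemma planeRefl_planeRefl (he : ‖e‖ = 1) (t : ℝ) (x : EuclideanSpace ℝ (Fin N)) :
    planeRefl e t (planeRefl e t x) = x := by
  rw [planeRefl, inner_planeRefl he, planeRefl]
  module

lemma planeRefl_neg (x : EuclideanSpace ℝ (Fin N)) : planeRefl (-e) 0 x = planeRefl e 0 x := by
  simp [planeRefl]

lemma norm_planeRefl_zero (he : ‖e‖ = 1) (x : EuclideanSpace ℝ (Fin N)) :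
    ‖planeRefl e 0 x‖ = ‖x‖ := by
  have := norm_sq_planeRefl he 0 x
  simp only [mul_zero, zero_mul, add_zero] at this
  exact (pow_left_inj₀ (norm_nonneg _) (norm_nonneg _) two_ne_zero).1 this

lemma continuous_planeRefl :
    Continuous fun q : ℝ × EuclideanSpace ℝ (Fin N) => planeRefl e q.1 q.2 := by
  unfold planeRefl; fun_prop

lemma contDiff_planeRefl (t : ℝ) : ContDiff ℝ 2 (planeRefl e t) :=
  contDiff_id.add ((contDiff_const.mul (contDiff_const.sub
    (contDiff_id.inner ℝ contDiff_const))).smul contDiff_const)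

lemma lapl_comp_planeRefl (he : ‖e‖ = 1) {f : EuclideanSpace ℝ (Fin N) → ℝ}
    (hf : ContDiff ℝ 2 f) (t : ℝ) (x : EuclideanSpace ℝ (Fin N)) :
    lapl (fun y => f (planeRefl e t y)) x = lapl f (planeRefl e t x) := by
  simp only [planeRefl_eq he]
  exact lapl_comp_isometry hf _ _ _

lemma fderiv_comp_planeRefl (he : ‖e‖ = 1) {f : EuclideanSpace ℝ (Fin N) → ℝ}
    (hf : Differentiable ℝ f) (t : ℝ) (x : EuclideanSpace ℝ (Fin N)) :
    fderiv ℝ (fun y => f (planeRefl e t y)) x e = -fderiv ℝ f (planeRefl e t x) e := by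
  have h1 : HasFDerivAt (planeRefl e t) (fderiv ℝ (planeRefl e t) x) x :=
    ((contDiff_planeRefl t).differentiable (by norm_num) x).hasFDerivAt
  have h2 := (hf (planeRefl e t x)).hasFDerivAt.comp x h1
  have h3 : fderiv ℝ (planeRefl e t) x e = -e := by
    have h4 : HasDerivAt (fun s : ℝ => planeRefl e t (x + s • e)) (-e) 0 := by
      have h5 : (fun s : ℝ => planeRefl e t (x + s • e)) =
          fun s => planeRefl e t x + s • (-e) := by
        ext1 s
        rw [planeRefl, planeRefl, inner_add_left, real_inner_smul_left,
          real_inner_self_eq_norm_sq, he]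
        module
      rw [h5]
      simpa using ((hasDerivAt_id (0 : ℝ)).smul_const (-e)).const_add (planeRefl e t x)
    have h6 : HasDerivAt (fun s : ℝ => x + s • e) e 0 := by
      simpa using ((hasDerivAt_id (0 : ℝ)).smul_const e).const_add x
    have h7 : HasFDerivAt (planeRefl e t) (fderiv ℝ (planeRefl e t) x) (x + (0 : ℝ) • e) := by
      simpa using h1
    have h8 : HasDerivAt (planeRefl e t ∘ fun s : ℝ => x + s • e)
        (fderiv ℝ (planeRefl e t) x e) 0 := h7.comp_hasDerivAt 0 h6
    exact h8.unique h4
  change fderiv ℝ (f ∘ planeRefl e t) x e = _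
  rw [h2.fderiv, ContinuousLinearMap.comp_apply, h3, map_neg]

/-- A function vanishing on a sphere has vanishing tangential derivatives there. -/
lemma fderiv_eq_zero_of_tangent {R : ℝ} {f : EuclideanSpace ℝ (Fin N) → ℝ}
    {x v : EuclideanSpace ℝ (Fin N)} (hf : DifferentiableAt ℝ f x)
    (h0 : ∀ y, ‖y‖ = R → f y = 0) (hx : ‖x‖ = R)
    (hx0 : x ≠ 0) (hv : inner ℝ x v = 0) :
    fderiv ℝ f x v = 0 := by
  rcases eq_or_ne v 0 with rfl | hv0
  · simp
  have hvn : 0 < ‖v‖ := norm_pos_iff.2 hv0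
  set u : EuclideanSpace ℝ (Fin N) := (‖x‖ / ‖v‖) • v with hu
  have hun : ‖u‖ = ‖x‖ := by
    rw [hu, norm_smul, Real.norm_eq_abs, abs_of_nonneg (by positivity)]
    field_simp
  have hxu : inner ℝ x u = 0 := by rw [hu, real_inner_smul_right, hv, mul_zero]
  have hγ : ∀ s : ℝ, ‖Real.cos s • x + Real.sin s • u‖ = R := fun s => by
    rw [← hx]
    refine (pow_left_inj₀ (norm_nonneg _) (norm_nonneg _) two_ne_zero).1 ?_
    rw [norm_add_sq_real, real_inner_smul_left, real_inner_smul_right, hxu, norm_smul, norm_smul,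
      hun, Real.norm_eq_abs, Real.norm_eq_abs, mul_pow, mul_pow, sq_abs, sq_abs]
    linear_combination ‖x‖ ^ 2 * Real.cos_sq_add_sin_sq s
  have h1 : HasDerivAt (fun s : ℝ => Real.cos s • x + Real.sin s • u) u 0 := by
    have := ((Real.hasDerivAt_cos 0).smul_const x).fun_add
      ((Real.hasDerivAt_sin 0).smul_const u)
    simpa using this
  have h2 : HasFDerivAt f (fderiv ℝ f x) (Real.cos 0 • x + Real.sin 0 • u) := by
    simpa using hf.hasFDerivAt
  have h3 : HasDerivAt (fun s : ℝ => f (Real.cos s • x + Real.sin s • u)) (fderiv ℝ f x u) 0 :=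
    h2.comp_hasDerivAt 0 h1
  have h4 : (fun s : ℝ => f (Real.cos s • x + Real.sin s • u)) = fun _ => 0 :=
    funext fun s => h0 _ (hγ s)
  rw [h4] at h3
  have h5 : fderiv ℝ f x u = 0 := h3.unique (hasDerivAt_const 0 0)
  rw [hu, map_smul, smul_eq_mul, mul_eq_zero] at h5
  rcases h5 with h5 | h5
  · exact absurd h5 (div_pos (norm_pos_iff.2 hx0) hvn).ne'
  · exact h5

end MovingPlanes

section Caps

/-- The projection to the first factor of a closed set is closed when the second factor stays in a
compact set. -/
lemma isClosed_image_fst {X Y : Type*} [TopologicalSpace X] [TopologicalSpace Y] {K : Set Y}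
    (hK : IsCompact K) {S : Set (X × Y)} (hS : IsClosed S) (hSK : ∀ q ∈ S, q.2 ∈ K) :
    IsClosed (Prod.fst '' S) := by
  have : CompactSpace K := isCompact_iff_compactSpace.1 hK
  have h1 : IsClosed ((fun q : X × K => (q.1, (q.2 : Y))) ⁻¹' S) := hS.preimage (by fun_prop)
  have h2 := isClosedMap_fst_of_compactSpace _ h1
  convert h2 using 1
  ext x
  constructor
  · rintro ⟨⟨a, b⟩, hab, rfl⟩
    exact ⟨(a, ⟨b, hSK _ hab⟩), hab, rfl⟩
  · rintro ⟨⟨a, b⟩, hab, rfl⟩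
    exact ⟨(a, b), hab, rfl⟩

/-- Method of continuity. -/
lemma subset_of_closed_dichotomy {I A S : Set ℝ} (hI : IsPreconnected I) (hA : IsClosed A)
    (hS : IsClosed S) (h1 : ∀ t ∈ I, t ∉ S → t ∈ A) (h2 : ∀ t ∈ I, t ∈ S → t ∉ A)
    (h3 : (I ∩ S).Nonempty) : I ⊆ S := by
  intro t ht
  by_contra hts
  obtain ⟨s, hs, hs1, hs2⟩ := isPreconnected_closed_iff.1 hI S A hS hA
    (fun s hs => or_iff_not_imp_left.2 (h1 s hs)) h3 ⟨t, ht, h1 t ht hts⟩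
  exact h2 s hs hs1 hs2

variable {N : ℕ} {e : EuclideanSpace ℝ (Fin N)} {t R : ℝ} {w : EuclideanSpace ℝ (Fin N) → ℝ}

/-- Strong maximum principle and Hopf lemma on a ball cut by a hyperplane. -/
lemma pos_of_lapl_nonpos_cap (hN : 0 < N) (he : ‖e‖ = 1) (hc : Continuous w)
    (hd : ∀ x, ‖x‖ < R → t < inner ℝ x e → ContDiffAt ℝ 2 w x)
    (hl : ∀ x, ‖x‖ < R → t < inner ℝ x e → lapl w x ≤ 0)
    (hnn : ∀ x, ‖x‖ < R → t < inner ℝ x e → 0 ≤ w x)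
    (hex : ∃ x, ‖x‖ < R ∧ t < inner ℝ x e ∧ 0 < w x) :
    (∀ x, ‖x‖ < R → t < inner ℝ x e → 0 < w x) ∧
    ∀ x, ‖x‖ < R → inner ℝ x e = t → w x = 0 → DifferentiableAt ℝ w x →
      0 < fderiv ℝ w x e := by
  set Ω : Set (EuclideanSpace ℝ (Fin N)) := ball 0 R ∩ {x | t < inner ℝ x e} with hΩ
  have ho : IsOpen Ω := isOpen_ball.inter (isOpen_lt continuous_const (by fun_prop))
  have hconv : Convex ℝ Ω := by
    refine (convex_ball _ _).inter ?_
    intro x hx y hy a b ha hb hab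
    simp only [mem_ofPred_eq] at *
    rw [inner_add_left, real_inner_smul_left, real_inner_smul_left]
    rcases ha.eq_or_lt with rfl | ha
    · have : b = 1 := by linarith
      subst this; linarith
    · have : t = a * t + b * t := by rw [← add_mul, hab, one_mul]
      rw [this]
      nlinarith
  have hmem : ∀ x, x ∈ Ω ↔ ‖x‖ < R ∧ t < inner ℝ x e := fun x => by simp [hΩ]
  obtain ⟨z, hz1, hz2, hz3⟩ := hex
  have hpos : ∀ x, ‖x‖ < R → t < inner ℝ x e → 0 < w x := fun x h1 h2 =>
    pos_of_lapl_nonpos hN ho hconv.isPreconnected hc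
      (fun x hx => hd x ((hmem x).1 hx).1 ((hmem x).1 hx).2)
      (fun x hx => hl x ((hmem x).1 hx).1 ((hmem x).1 hx).2)
      (fun x hx => hnn x ((hmem x).1 hx).1 ((hmem x).1 hx).2)
      ⟨z, (hmem z).2 ⟨hz1, hz2⟩, hz3⟩ x ((hmem x).2 ⟨h1, h2⟩)
  refine ⟨hpos, fun x hx hxt hwx hdx => ?_⟩
  set ρ := (R - ‖x‖) / 2 with hρ
  have hρ0 : 0 < ρ := by rw [hρ]; linarith
  have hball : ∀ z ∈ ball (x + ρ • e) ρ, ‖z‖ < R ∧ t < inner ℝ z e := fun z hz => by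
    rw [mem_ball_iff_norm] at hz
    have hzx : z = x + ρ • e + (z - (x + ρ • e)) := by abel
    constructor
    · calc ‖z‖ = ‖x + ρ • e + (z - (x + ρ • e))‖ := by rw [← hzx]
        _ ≤ ‖x‖ + ‖ρ • e‖ + ‖z - (x + ρ • e)‖ :=
          (norm_add_le _ _).trans (by gcongr; exact norm_add_le _ _)
        _ < ‖x‖ + ρ + ρ := by
          rw [norm_smul, he, mul_one, Real.norm_eq_abs, abs_of_pos hρ0]; linarith
        _ = R := by rw [hρ]; ring
    · have h1 : inner ℝ z e = t + ρ + inner ℝ (z - (x + ρ • e)) e := by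
        rw [inner_sub_left, inner_add_left, real_inner_smul_left, real_inner_self_eq_norm_sq, he,
          hxt]
        ring
      have h2 := neg_le_of_abs_le (abs_real_inner_le_norm (z - (x + ρ • e)) e)
      rw [he, mul_one] at h2
      linarith
  have h := hopf_ball hN (y := x + ρ • e) (x₀ := x) hρ0 hc
    (fun z hz => hd z (hball z hz).1 (hball z hz).2)
    (fun z hz => hl z (hball z hz).1 (hball z hz).2)
    (fun z hz => hpos z (hball z hz).1 (hball z hz).2)
    (by rw [mem_sphere_iff_norm]
        simp [norm_smul, he, abs_of_pos hρ0]) hwx hdx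
  rw [add_sub_cancel_left, map_smul, smul_eq_mul] at h
  exact pos_of_mul_pos_right h hρ0.le

lemma exists_pos_cap (he : ‖e‖ = 1) (hR : 0 < R) (htR : t < R) (hc : Continuous w)
    (hw : 0 < w (R • e)) : ∃ x, ‖x‖ < R ∧ t < inner ℝ x e ∧ 0 < w x := by
  have hcont : Continuous fun s : ℝ => w (s • e) := hc.comp (continuous_id.smul continuous_const)
  have h1 : ∀ᶠ s in 𝓝[<] R, t < s ∧ 0 < w (s • e) :=
    nhdsWithin_le_nhds ((lt_mem_nhds htR).and (hcont.continuousAt.eventually (lt_mem_nhds hw)))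
  obtain ⟨s, ⟨hs1, hs2⟩, hs3⟩ := (h1.and (Ioo_mem_nhdsLT hR)).exists
  refine ⟨s • e, ?_, ?_, hs2⟩
  · rw [norm_smul, he, mul_one, Real.norm_eq_abs, abs_of_pos hs3.1]; exact hs3.2
  · rw [real_inner_smul_left, real_inner_self_eq_norm_sq, he]; linarith

/-- A function that is nonnegative on the boundary of a cap and negative somewhere in it has a
critical point with negative value. -/
lemma exists_critical_of_neg_cap (hc : Continuous w)
    (h1 : ∀ x, ‖x‖ = R → t ≤ inner ℝ x e → 0 ≤ w x)
    (h2 : ∀ x, ‖x‖ ≤ R → inner ℝ x e = t → 0 ≤ w x)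
    (hneg : ∃ x, ‖x‖ ≤ R ∧ t ≤ inner ℝ x e ∧ w x < 0) :
    ∃ x, ‖x‖ < R ∧ t < inner ℝ x e ∧ w x < 0 ∧ fderiv ℝ w x = 0 := by
  obtain ⟨z, hz1, hz2, hz3⟩ := hneg
  have hK : IsCompact (closedBall (0 : EuclideanSpace ℝ (Fin N)) R ∩ {x | t ≤ inner ℝ x e}) :=
    (isCompact_closedBall _ _).inter_right (isClosed_le continuous_const (by fun_prop))
  obtain ⟨x, ⟨hx1, hx2⟩, hmin⟩ := hK.exists_isMinOn ⟨z, by simpa using hz1, hz2⟩ hc.continuousOn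
  have hx1' : ‖x‖ ≤ R := by simpa using hx1
  have hwx : w x < 0 := (hmin ⟨by simpa using hz1, hz2⟩ : w x ≤ w z).trans_lt hz3
  have hxR : ‖x‖ < R := hx1'.lt_of_ne fun h => (h1 x h hx2).not_gt hwx
  have hxt : t < inner ℝ x e :=
    (show t ≤ inner ℝ x e from hx2).lt_of_ne fun h => (h2 x hx1' h.symm).not_gt hwx
  refine ⟨x, hxR, hxt, hwx, IsLocalMin.fderiv_eq_zero ?_⟩
  have hU : ball (0 : EuclideanSpace ℝ (Fin N)) R ∩ {x | t < inner ℝ x e} ∈ 𝓝 x :=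
    (isOpen_ball.inter (isOpen_lt continuous_const (by fun_prop))).mem_nhds
      ⟨by simpa using hxR, hxt⟩
  filter_upwards [hU] with y hy
  exact hmin ⟨ball_subset_closedBall hy.1, (show t < inner ℝ y e from hy.2).le⟩

end Caps

section Symmetry

variable {N : ℕ} {e : EuclideanSpace ℝ (Fin N)} {R : ℝ} {f : ℝ → ℝ}
  {ψ : EuclideanSpace ℝ (Fin N) → ℝ}

/-- A positive superharmonic function vanishing on a sphere decreases strictly in outward
directions there. -/
lemma fderiv_neg_of_norm_eq (hN : 0 < N) (hR : 0 < R) (hψ : ContDiff ℝ 2 ψ)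
    (hl : ∀ x, ‖x‖ < R → lapl ψ x ≤ 0) (h0 : ∀ x, ‖x‖ = R → ψ x = 0)
    (hpos : ∀ x, ‖x‖ < R → 0 < ψ x) {x v : EuclideanSpace ℝ (Fin N)} (hx : ‖x‖ = R)
    (hv : 0 < inner ℝ x v) : fderiv ℝ ψ x v < 0 := by
  have hd := hψ.differentiable (by norm_num)
  have hx0 : x ≠ 0 := by rintro rfl; simp at hv
  have h := hopf_ball hN (y := 0) (x₀ := x) hR hψ.continuous (fun x _ => hψ.contDiffAt)
    (fun x hx => hl x (by simpa using hx)) (fun x hx => hpos x (by simpa using hx))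
    (by simpa using hx) (h0 x hx) (hd x)
  rw [zero_sub, map_neg] at h
  have ht := fderiv_eq_zero_of_tangent (v := v - (inner ℝ x v / ‖x‖ ^ 2) • x) (hd x) h0 hx hx0
    (by rw [inner_sub_right, real_inner_smul_right, real_inner_self_eq_norm_sq]
        have : ‖x‖ ≠ 0 := norm_ne_zero_iff.2 hx0
        field_simp; ring)
  rw [map_sub, map_smul, smul_eq_mul, sub_eq_zero] at ht
  rw [ht]
  exact mul_neg_of_pos_of_neg (div_pos hv (by rw [hx]; positivity)) (by linarith)

lemma norm_planeRefl_lt (he : ‖e‖ = 1) {t : ℝ} (ht : 0 < t) {x : EuclideanSpace ℝ (Fin N)}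
    (hx : t < inner ℝ x e) : ‖planeRefl e t x‖ < ‖x‖ := by
  refine lt_of_pow_lt_pow_left₀ 2 (norm_nonneg _) ?_
  rw [norm_sq_planeRefl he]
  nlinarith

lemma inner_le_of_norm_le (he : ‖e‖ = 1) {x : EuclideanSpace ℝ (Fin N)} (hx : ‖x‖ ≤ R) :
    inner ℝ x e ≤ R := by
  have := real_inner_le_norm x e
  rw [he, mul_one] at this
  exact this.trans hx

lemma cap_step (hN : 0 < N) (hψ : ContDiff ℝ 2 ψ) (hf : Monotone f)
    (hl : ∀ x, ‖x‖ < R → -lapl ψ x = f (ψ x)) (h0 : ∀ x, ‖x‖ = R → ψ x = 0)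
    (hpos : ∀ x, ‖x‖ < R → 0 < ψ x) (he : ‖e‖ = 1) {t : ℝ} (ht0 : 0 < t) (htR : t < R)
    (hP : ∀ x, ‖x‖ ≤ R → t < inner ℝ x e → ψ x ≤ ψ (planeRefl e t x)) :
    (∀ x, ‖x‖ ≤ R → t < inner ℝ x e → ψ x < ψ (planeRefl e t x)) ∧
    ∀ x, ‖x‖ < R → inner ℝ x e = t → fderiv ℝ ψ x e < 0 := by
  have hd := hψ.differentiable (by norm_num)
  have hcomp : ContDiff ℝ 2 fun y => ψ (planeRefl e t y) := hψ.comp (contDiff_planeRefl t)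
  have hW : ContDiff ℝ 2 fun y => ψ (planeRefl e t y) - ψ y := hcomp.sub hψ
  have hsph : ∀ x, ‖x‖ = R → t < inner ℝ x e → 0 < ψ (planeRefl e t x) - ψ x := fun x hx hxt => by
    rw [h0 x hx, sub_zero]
    exact hpos _ ((norm_planeRefl_lt he ht0 hxt).trans_le hx.le)
  have hRe : ∃ x, ‖x‖ < R ∧ t < inner ℝ x e ∧ 0 < ψ (planeRefl e t x) - ψ x := by
    refine exists_pos_cap he (ht0.trans htR) htR hW.continuous (hsph _ ?_ ?_)
    · rw [norm_smul, he, mul_one, Real.norm_eq_abs, abs_of_pos (ht0.trans htR)]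
    · rw [real_inner_smul_left, real_inner_self_eq_norm_sq, he]; linarith
  obtain ⟨hA, hB⟩ := pos_of_lapl_nonpos_cap hN he hW.continuous (fun x _ _ => hW.contDiffAt)
    (fun x hx hxt => by
      have hx' := (norm_planeRefl_lt he ht0 hxt).trans hx
      have h1 := hl _ hx'
      have h2 := hl _ hx
      have h3 := hf (hP x hx.le hxt)
      rw [lapl_sub hcomp.contDiffAt hψ.contDiffAt, lapl_comp_planeRefl he hψ]
      linarith)
    (fun x hx hxt => sub_nonneg.2 (hP x hx.le hxt)) hRe
  constructor
  · intro x hx hxt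
    rcases hx.eq_or_lt with hx | hx
    · exact sub_pos.1 (hsph x hx hxt)
    · exact sub_pos.1 (hA x hx hxt)
  · intro x hx hxt
    have h1 := hB x hx hxt (by rw [planeRefl_of_inner_eq hxt, sub_self])
      (hW.differentiable (by norm_num) x)
    rw [fderiv_fun_sub (hcomp.differentiable (by norm_num) x) (hd x),
      sub_apply, fderiv_comp_planeRefl he hd, planeRefl_of_inner_eq hxt] at h1
    linarith

/-- Moving planes. -/
lemma le_planeRefl (hN : 0 < N) (hR : 0 < R) (hψ : ContDiff ℝ 2 ψ) (hf : Monotone f)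
    (hf0 : ∀ s, 0 ≤ f s)
    (hl : ∀ x, ‖x‖ < R → -lapl ψ x = f (ψ x)) (h0 : ∀ x, ‖x‖ = R → ψ x = 0)
    (hpos : ∀ x, ‖x‖ < R → 0 < ψ x) (he : ‖e‖ = 1) :
    ∀ t ∈ Ioo 0 R, ∀ x, ‖x‖ ≤ R → t < inner ℝ x e → ψ x ≤ ψ (planeRefl e t x) := by
  have hd := hψ.differentiable (by norm_num)
  have hnn : ∀ x, ‖x‖ ≤ R → 0 ≤ ψ x := fun x hx =>
    hx.eq_or_lt.elim (fun h => (h0 x h).ge) fun h => (hpos x h).le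
  have hcorner := fun (x : EuclideanSpace ℝ (Fin N)) (hx : ‖x‖ = R) (hv : 0 < inner ℝ x e) =>
    fderiv_neg_of_norm_eq hN hR hψ (fun x hx => by linarith [hl x hx, hf0 (ψ x)]) h0 hpos hx hv
  have hfd : Continuous fun x => fderiv ℝ ψ x e :=
    (hψ.continuous_fderiv (by norm_num)).clm_apply continuous_const
  set S : Set (ℝ × EuclideanSpace ℝ (Fin N)) :=
    {q | q.2 ∈ closedBall 0 R ∧ q.1 ≤ inner ℝ q.2 e ∧ ψ (planeRefl e q.1 q.2) ≤ ψ q.2 ∧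
      fderiv ℝ ψ (planeRefl e q.1 q.2) e + fderiv ℝ ψ q.2 e = 0} with hS
  have hSc : IsClosed S := by
    refine (isClosed_closedBall.preimage continuous_snd).inter ((isClosed_le continuous_fst
      (by fun_prop)).inter ((isClosed_le (hψ.continuous.comp continuous_planeRefl)
        (hψ.continuous.comp continuous_snd)).inter (isClosed_eq ?_ continuous_const)))
    exact (hfd.comp continuous_planeRefl).add (hfd.comp continuous_snd)
  have hA : IsClosed (Prod.fst '' S) :=
    isClosed_image_fst (isCompact_closedBall 0 R) hSc fun q hq => hq.1
  set P : Set ℝ := {t | ∀ x, ‖x‖ ≤ R → t < inner ℝ x e → ψ x ≤ ψ (planeRefl e t x)} with hP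
  have hPc : IsClosed P := by
    have : P = ⋂ (x : EuclideanSpace ℝ (Fin N)) (_ : ‖x‖ ≤ R),
        ({t | inner ℝ x e ≤ t} ∪ {t | ψ x ≤ ψ (planeRefl e t x)}) := by
      ext t
      simp only [hP, mem_ofPred_eq, mem_iInter, mem_union, ← not_lt (b := inner ℝ _ e)]
      exact forall₂_congr fun x _ => imp_iff_not_or
    rw [this]
    refine isClosed_iInter fun x => isClosed_iInter fun _ =>
      (isClosed_le continuous_const continuous_id).union (isClosed_le continuous_const
        (hψ.continuous.comp (continuous_planeRefl.comp (Continuous.prodMk_left x))))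
  have h1 : ∀ t ∈ Ioo 0 R, t ∉ P → t ∈ Prod.fst '' S := by
    intro t ht htP
    simp only [hP, mem_ofPred_eq, not_forall, not_le] at htP
    obtain ⟨z, hz1, hz2, hz3⟩ := htP
    have hcomp : ContDiff ℝ 2 fun y => ψ (planeRefl e t y) := hψ.comp (contDiff_planeRefl t)
    obtain ⟨x, hx1, hx2, hx3, hx4⟩ := exists_critical_of_neg_cap (R := R) (t := t) (e := e)
      (w := fun y => ψ (planeRefl e t y) - ψ y) (hcomp.continuous.sub hψ.continuous)
      (fun x hx hxt => by
        rw [h0 x hx, sub_zero]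
        refine hnn _ ?_
        rcases hxt.eq_or_lt with h | h
        · rw [planeRefl_of_inner_eq h.symm, hx]
        · exact (norm_planeRefl_lt he ht.1 h).le.trans hx.le)
      (fun x hx hxt => by rw [planeRefl_of_inner_eq hxt, sub_self])
      ⟨z, hz1, hz2.le, sub_neg.2 hz3⟩
    refine ⟨(t, x), ⟨by simpa using hx1.le, hx2.le, (sub_neg.1 hx3).le, ?_⟩, rfl⟩
    have h := DFunLike.congr_fun hx4 e
    rw [fderiv_fun_sub (hcomp.differentiable (by norm_num) x) (hd x),
      sub_apply, fderiv_comp_planeRefl he hd,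
      zero_apply] at h
    simp only
    linarith
  have h2 : ∀ t ∈ Ioo 0 R, t ∈ P → t ∉ Prod.fst '' S := by
    rintro t ht htP ⟨⟨t', x⟩, ⟨hx1, hx2, hx3, hx4⟩, rfl⟩
    simp only at *
    have hx1' : ‖x‖ ≤ R := by simpa using hx1
    obtain ⟨hA, hB⟩ := cap_step hN hψ hf hl h0 hpos he ht.1 ht.2 htP
    rcases hx2.eq_or_lt with h | h
    · rw [planeRefl_of_inner_eq h.symm] at hx4
      have : fderiv ℝ ψ x e < 0 := by
        rcases hx1'.eq_or_lt with h' | h'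
        · exact hcorner x h' (by rw [← h]; exact ht.1)
        · exact hB x h' h.symm
      linarith
    · exact (hA x hx1' h).not_ge hx3
  have h3 : R ∉ Prod.fst '' S := by
    rintro ⟨⟨t', x⟩, ⟨hx1, hx2, hx3, hx4⟩, rfl⟩
    simp only at *
    have hx1' : ‖x‖ ≤ t' := by simpa using hx1
    have hxe : inner ℝ x e = t' := le_antisymm (inner_le_of_norm_le he hx1') hx2
    rw [planeRefl_of_inner_eq hxe] at hx4
    have hxn : ‖x‖ = t' := le_antisymm hx1' (by
      rw [← hxe]; exact inner_le_of_norm_le he le_rfl)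
    have := hcorner x hxn (by rw [hxe]; exact hR)
    linarith
  have h4 : (Ioo 0 R ∩ P).Nonempty := by
    have h5 : ∀ᶠ t in 𝓝[<] R, t ∈ Ioo 0 R ∧ t ∉ Prod.fst '' S :=
      inter_mem (Ioo_mem_nhdsLT hR) (nhdsWithin_le_nhds (hA.isOpen_compl.mem_nhds h3))
    obtain ⟨t, ht1, ht2⟩ := h5.exists
    exact ⟨t, ht1, by_contra fun h => ht2 (h1 t ht1 h)⟩
  exact subset_of_closed_dichotomy isPreconnected_Ioo hA hPc h1 h2 h4

lemma fderiv_neg_of_inner_pos (hN : 0 < N) (hR : 0 < R) (hψ : ContDiff ℝ 2 ψ) (hf : Monotone f)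
    (hf0 : ∀ s, 0 ≤ f s)
    (hl : ∀ x, ‖x‖ < R → -lapl ψ x = f (ψ x)) (h0 : ∀ x, ‖x‖ = R → ψ x = 0)
    (hpos : ∀ x, ‖x‖ < R → 0 < ψ x) (he : ‖e‖ = 1) {x : EuclideanSpace ℝ (Fin N)}
    (hx : ‖x‖ ≤ R) (hxe : 0 < inner ℝ x e) : fderiv ℝ ψ x e < 0 := by
  rcases hx.eq_or_lt with h | h
  · exact fderiv_neg_of_norm_eq hN hR hψ (fun x hx => by linarith [hl x hx, hf0 (ψ x)]) h0 hpos
      h hxe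
  · have hlt := (inner_le_of_norm_le he le_rfl).trans_lt h
    exact (cap_step hN hψ hf hl h0 hpos he hxe hlt
      (le_planeRefl hN hR hψ hf hf0 hl h0 hpos he _ ⟨hxe, hlt⟩)).2 x h rfl

lemma eq_planeRefl_zero (hN : 0 < N) (hR : 0 < R) (hψ : ContDiff ℝ 2 ψ) (hf : Monotone f)
    (hf0 : ∀ s, 0 ≤ f s)
    (hl : ∀ x, ‖x‖ < R → -lapl ψ x = f (ψ x)) (h0 : ∀ x, ‖x‖ = R → ψ x = 0)
    (hpos : ∀ x, ‖x‖ < R → 0 < ψ x) (he : ‖e‖ = 1) {x : EuclideanSpace ℝ (Fin N)}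
    (hx : ‖x‖ ≤ R) : ψ (planeRefl e 0 x) = ψ x := by
  have key : ∀ (e x : EuclideanSpace ℝ (Fin N)), ‖e‖ = 1 → ‖x‖ ≤ R → 0 < inner ℝ x e →
      ψ x ≤ ψ (planeRefl e 0 x) := fun e x he hx hxe => by
    have hcont : Continuous fun t => ψ (planeRefl e t x) :=
      hψ.continuous.comp (continuous_planeRefl.comp (Continuous.prodMk_left x))
    refine ge_of_tendsto (hcont.continuousWithinAt (s := Ioi 0) (x := 0)).tendsto ?_
    filter_upwards [Ioo_mem_nhdsGT hR, Ioo_mem_nhdsGT hxe] with t ht1 ht2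
    exact le_planeRefl hN hR hψ hf hf0 hl h0 hpos he t ht1 x hx ht2.2
  have key2 : ∀ (e x : EuclideanSpace ℝ (Fin N)), ‖e‖ = 1 → ‖x‖ ≤ R → 0 < inner ℝ x e →
      ψ (planeRefl e 0 x) = ψ x := fun e x he hx hxe => by
    refine le_antisymm ?_ (key e x he hx hxe)
    have := key (-e) (planeRefl e 0 x) (by rwa [norm_neg])
      (by rwa [norm_planeRefl_zero he]) (by
        rw [inner_neg_right, inner_planeRefl he]; linarith)
    rwa [planeRefl_neg, planeRefl_planeRefl he] at this
  rcases lt_trichotomy (inner ℝ x e) 0 with h | h | h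
  · rw [← planeRefl_neg]
    exact key2 (-e) x (by rwa [norm_neg]) hx (by rw [inner_neg_right]; linarith)
  · rw [planeRefl_of_inner_eq h]
  · exact key2 e x he hx h

/-- A function invariant under all reflections is radial. -/
lemma eq_of_norm_eq_of_planeRefl {g : EuclideanSpace ℝ (Fin N) → ℝ}
    (h : ∀ e : EuclideanSpace ℝ (Fin N), ‖e‖ = 1 → ∀ x, ‖x‖ ≤ R → g (planeRefl e 0 x) = g x)
    {x y : EuclideanSpace ℝ (Fin N)} (hx : ‖x‖ ≤ R) (hxy : ‖x‖ = ‖y‖) : g x = g y := by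
  rcases eq_or_ne x y with rfl | hne
  · rfl
  have hn : ‖x - y‖ ≠ 0 := norm_ne_zero_iff.2 (sub_ne_zero.2 hne)
  have he : ‖(‖x - y‖⁻¹ • (x - y))‖ = 1 := by
    rw [norm_smul, norm_inv, norm_norm, inv_mul_cancel₀ hn]
  have h1 : planeRefl (‖x - y‖⁻¹ • (x - y)) 0 x = y := by
    have h2 : 2 * inner ℝ x (x - y) = ‖x - y‖ ^ 2 := by
      rw [norm_sub_sq_real, inner_sub_right, real_inner_self_eq_norm_sq, ← hxy]; ring
    have h3 : (2 * (0 - inner ℝ x (‖x - y‖⁻¹ • (x - y)))) • (‖x - y‖⁻¹ • (x - y)) =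
        -(x - y) := by
      rw [smul_smul, real_inner_smul_right, ← neg_one_smul ℝ (x - y)]
      congr 1
      field_simp
      linear_combination -h2
    rw [planeRefl, h3]; abel
  rw [← h _ he x hx, h1]

end Symmetry

/-! ### Radial functions -/

section Radial

lemma hasDerivAt_max_rpow {p : ℝ} (hp : 1 < p) (s : ℝ) :
    HasDerivAt (fun s : ℝ => (max s 0) ^ p) (p * (max s 0) ^ (p - 1)) s := by
  rcases lt_trichotomy s 0 with hs | rfl | hs
  · rw [max_eq_right hs.le, Real.zero_rpow (by linarith), mul_zero]
    refine (hasDerivAt_const s (0 : ℝ)).congr_of_eventuallyEq ?_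
    filter_upwards [gt_mem_nhds hs] with r hr
    rw [max_eq_right hr.le, Real.zero_rpow (by linarith)]
  · rw [max_self, Real.zero_rpow (by linarith), mul_zero]
    have h := hasDerivAt_abs_rpow 0 hp
    rw [mul_zero, hasDerivAt_iff_isLittleO_nhds_zero] at h
    rw [hasDerivAt_iff_isLittleO_nhds_zero]
    refine (Asymptotics.isBigO_of_le _ fun r => ?_).trans_isLittleO h
    simp only [zero_add, abs_zero, max_self, smul_zero, sub_zero,
      Real.zero_rpow (show p ≠ 0 by linarith), Real.norm_eq_abs]
    rw [abs_of_nonneg (by positivity), abs_of_nonneg (by positivity)]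
    exact Real.rpow_le_rpow (le_max_right _ _) (max_le (le_abs_self r) (abs_nonneg r)) (by linarith)
  · rw [max_eq_left hs.le]
    refine (Real.hasDerivAt_rpow_const (Or.inl hs.ne')).congr_of_eventuallyEq ?_
    filter_upwards [lt_mem_nhds hs] with r hr
    rw [max_eq_left hr.le]

variable {N : ℕ} {e : EuclideanSpace ℝ (Fin N)} {R : ℝ} {g : EuclideanSpace ℝ (Fin N) → ℝ}

lemma contDiff_profile {n : WithTop ℕ∞} (hg : ContDiff ℝ n g) :
    ContDiff ℝ n fun r : ℝ => g (r • e) :=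
  hg.comp (contDiff_id.smul contDiff_const)

lemma hasDerivAt_profile (hg : ContDiff ℝ 2 g) (r : ℝ) :
    HasDerivAt (fun r : ℝ => g (r • e)) (fderiv ℝ g (r • e) e) r := by
  have h1 : HasDerivAt (fun r : ℝ => r • e) e r := by
    simpa using (hasDerivAt_id r).smul_const e
  exact ((hg.differentiable (by norm_num) (r • e)).hasFDerivAt).comp_hasDerivAt r h1

lemma eq_profile (hrad : ∀ x y, ‖x‖ ≤ R → ‖x‖ = ‖y‖ → g x = g y) (he : ‖e‖ = 1)
    {x : EuclideanSpace ℝ (Fin N)} (hx : ‖x‖ ≤ R) : g x = g (‖x‖ • e) :=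
  hrad _ _ hx (by rw [norm_smul, he, mul_one, norm_norm])

lemma eventuallyEq_profile (hrad : ∀ x y, ‖x‖ ≤ R → ‖x‖ = ‖y‖ → g x = g y) (he : ‖e‖ = 1)
    {x : EuclideanSpace ℝ (Fin N)} (hx : ‖x‖ < R) : g =ᶠ[𝓝 x] fun y => g (‖y‖ • e) := by
  filter_upwards [continuous_norm.continuousAt.eventually (gt_mem_nhds hx)] with y hy
  exact eq_profile hrad he hy.le

lemma deriv_profile_zero (hR : 0 < R) (hg : ContDiff ℝ 2 g)
    (hrad : ∀ x y, ‖x‖ ≤ R → ‖x‖ = ‖y‖ → g x = g y) (he : ‖e‖ = 1) :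
    deriv (fun r : ℝ => g (r • e)) 0 = 0 := by
  have hd : HasDerivAt (fun r : ℝ => g (r • e)) (deriv (fun r : ℝ => g (r • e)) 0) 0 :=
    ((contDiff_profile hg).differentiable (by norm_num) 0).hasDerivAt
  have h1 : HasDerivAt (fun r : ℝ => g (-r • e)) (deriv (fun r : ℝ => g (r • e)) 0 * -1) 0 := by
    have h2 : HasDerivAt (fun r : ℝ => g (r • e)) (deriv (fun r : ℝ => g (r • e)) 0) (-0) := by
      simpa using hd
    exact h2.comp 0 (hasDerivAt_neg 0)
  have h3 : (fun r : ℝ => g (-r • e)) =ᶠ[𝓝 0] fun r : ℝ => g (r • e) := by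
    filter_upwards [Ioo_mem_nhds (neg_lt_zero.2 hR) hR] with r hr
    refine hrad _ _ ?_ (by simp)
    rw [norm_smul, he, mul_one, norm_neg, Real.norm_eq_abs, abs_le]
    exact ⟨hr.1.le, hr.2.le⟩
  have h4 := hd.unique (h1.congr_of_eventuallyEq h3.symm)
  linarith

lemma lapl_eq_profile (hg : ContDiff ℝ 2 g) (hrad : ∀ x y, ‖x‖ ≤ R → ‖x‖ = ‖y‖ → g x = g y)
    (he : ‖e‖ = 1) {x : EuclideanSpace ℝ (Fin N)} (hx0 : x ≠ 0) (hx : ‖x‖ < R) :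
    lapl g x = deriv (deriv fun r : ℝ => g (r • e)) ‖x‖ +
      (N - 1) * (deriv (fun r : ℝ => g (r • e)) ‖x‖ / ‖x‖) := by
  rw [lapl_congr (eventuallyEq_profile hrad he hx)]
  have hU : ContDiff ℝ 2 fun r : ℝ => g (r • e) := contDiff_profile hg
  have hU' : ContDiff ℝ 1 (deriv fun r : ℝ => g (r • e)) :=
    (contDiff_succ_iff_deriv.1
      (show ContDiff ℝ (1 + 1) _ by simpa [one_add_one_eq_two] using hU)).2.2
  exact lapl_radial hx0 (Eventually.of_forall fun r =>
      (hU.differentiable (by norm_num) r).hasDerivAt)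
    (hU'.differentiable (by norm_num) _).hasDerivAt

/-- The radial form of a semilinear equation. -/
lemma profile_ode (hg : ContDiff ℝ 2 g) (hrad : ∀ x y, ‖x‖ ≤ R → ‖x‖ = ‖y‖ → g x = g y)
    (he : ‖e‖ = 1) {F : EuclideanSpace ℝ (Fin N) → ℝ} (hF : ∀ x, ‖x‖ < R → -lapl g x = F x)
    {r : ℝ} (hr : r ∈ Ioo 0 R) :
    deriv (deriv fun r : ℝ => g (r • e)) r =
      -F (r • e) - (N - 1) * (deriv (fun r : ℝ => g (r • e)) r / r) := by
  have hn : ‖r • e‖ = r := by rw [norm_smul, he, mul_one, Real.norm_eq_abs, abs_of_pos hr.1]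
  have h0 : r • e ≠ 0 := norm_ne_zero_iff.1 (by rw [hn]; exact hr.1.ne')
  have h1 := hF (r • e) (by rw [hn]; exact hr.2)
  have h2 := lapl_eq_profile hg hrad he h0 (by rw [hn]; exact hr.2)
  rw [hn] at h2
  linarith

/-- Interior regularity, away from the origin, of radial solutions of a semilinear equation. -/
lemma contDiffAt_three_of_radial (hg : ContDiff ℝ 2 g)
    (hrad : ∀ x y, ‖x‖ ≤ R → ‖x‖ = ‖y‖ → g x = g y) (he : ‖e‖ = 1) {f : ℝ → ℝ}
    (hf : ContDiff ℝ 1 f) (hF : ∀ x, ‖x‖ < R → -lapl g x = f (g x))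
    {x : EuclideanSpace ℝ (Fin N)} (hx0 : x ≠ 0) (hx : ‖x‖ < R) : ContDiffAt ℝ 3 g x := by
  set U : ℝ → ℝ := fun r => g (r • e) with hUdef
  have hU : ContDiff ℝ 2 U := contDiff_profile hg
  have hU' : ContDiff ℝ 1 (deriv U) :=
    (contDiff_succ_iff_deriv.1
      (show ContDiff ℝ (1 + 1) _ by simpa [one_add_one_eq_two] using hU)).2.2
  have h2 : ContDiffOn ℝ 1 (deriv (deriv U)) (Ioo 0 R) := by
    have h3 : ContDiffOn ℝ 1 (fun r => -f (U r) - (N - 1) * (deriv U r / r)) (Ioo 0 R) :=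
      ((hf.comp (hU.of_le (by norm_num))).neg.contDiffOn).sub
        (contDiffOn_const.mul (hU'.contDiffOn.div contDiffOn_id fun r hr => hr.1.ne'))
    exact h3.congr fun r hr => profile_ode hg hrad he hF hr
  have h3 : ContDiffOn ℝ (1 + 1) (deriv U) (Ioo 0 R) :=
    (contDiffOn_succ_iff_deriv_of_isOpen isOpen_Ioo).2
      ⟨(hU'.differentiable (by norm_num)).differentiableOn, by simp, h2⟩
  have h4 : ContDiffOn ℝ ((1 + 1) + 1) U (Ioo 0 R) :=
    (contDiffOn_succ_iff_deriv_of_isOpen isOpen_Ioo).2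
      ⟨(hU.differentiable (by norm_num)).differentiableOn, by simp, h3⟩
  have h5 : ContDiffAt ℝ 3 U ‖x‖ := by
    have := h4.contDiffAt (isOpen_Ioo.mem_nhds ⟨norm_pos_iff.2 hx0, hx⟩)
    convert this using 1
    norm_num
  exact (h5.comp x (contDiffAt_norm ℝ hx0)).congr_of_eventuallyEq (eventuallyEq_profile hrad he hx)

end Radial

section EigenSymmetry

variable {N : ℕ} {e : EuclideanSpace ℝ (Fin N)} {R : ℝ}

/-- At a point of the sphere, the second tangential derivative of a function vanishing on the
sphere is determined by its radial derivative. -/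
lemma fderiv_fderiv_tangent {ψ : EuclideanSpace ℝ (Fin N) → ℝ} (hR : 0 < R)
    (hψ : ContDiff ℝ 2 ψ) (h0 : ∀ x, ‖x‖ = R → ψ x = 0) (he : ‖e‖ = 1)
    {x : EuclideanSpace ℝ (Fin N)} (hx : ‖x‖ = R) (hxe : inner ℝ x e = 0) :
    R ^ 2 * fderiv ℝ (fun y => fderiv ℝ ψ y e) x e = fderiv ℝ ψ x x := by
  have hx0 : ∀ y : EuclideanSpace ℝ (Fin N), ‖y‖ = R → y ≠ 0 := by
    rintro y hy rfl; simp at hy; linarith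
  have hfd : ∀ a, Differentiable ℝ fun y => fderiv ℝ ψ y a := fun a =>
    ((hψ.fderiv_right (m := 1) (by norm_num)).clm_apply contDiff_const).differentiable (by norm_num)
  have hin : ∀ a, HasFDerivAt (fun y : EuclideanSpace ℝ (Fin N) => inner ℝ y a)
      (innerSL ℝ a) x := fun a => by
    have := (innerSL ℝ a).hasFDerivAt (x := x)
    convert this using 2
    rw [innerSL_apply_apply, real_inner_comm]
  have h1 := ((hin x).mul (hfd e x).hasFDerivAt).sub ((hin e).mul (hfd x x).hasFDerivAt)
  have h2 := fderiv_eq_zero_of_tangent (R := R) (v := e) h1.differentiableAt (fun y hy => by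
    have := fderiv_eq_zero_of_tangent (v := inner ℝ y x • e - inner ℝ y e • x)
      (hψ.differentiable (by norm_num) y) h0 hy (hx0 y hy)
      (by rw [inner_sub_right, real_inner_smul_right, real_inner_smul_right]; ring)
    simpa using this) hx (hx0 x hx) hxe
  rw [h1.fderiv] at h2
  simp [hxe, hx, he] at h2
  linarith

/-- Comparison, on a half ball, of an odd eigenfunction with a positive supersolution. -/
lemma nonpos_of_eigen_cap (hN : 0 < N) (hR : 0 < R) (he : ‖e‖ = 1) {μ κ : ℝ} (hμ : 0 ≤ μ)
    (hμκ : μ ≤ κ) {V v g : EuclideanSpace ℝ (Fin N) → ℝ} (hV : ∀ x, 0 ≤ V x)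
    (hg : ContDiff ℝ 2 g) (hg1 : ∀ x, ‖x‖ = R → g x = 0)
    (hg2 : ∀ x, ‖x‖ ≤ R → inner ℝ x e = 0 → g x = 0)
    (hgl : ∀ x, ‖x‖ < R → -lapl g x = μ * (V x * g x))
    (hv : ContDiff ℝ 1 v) (hv2 : ∀ x, ‖x‖ < R → 0 < inner ℝ x e → ContDiffAt ℝ 2 v x)
    (hvl : ∀ x, ‖x‖ < R → 0 < inner ℝ x e → -lapl v x = κ * (V x * v x))
    (hvpos : ∀ x, ‖x‖ ≤ R → 0 < inner ℝ x e → 0 < v x)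
    (hv0 : ∀ x, ‖x‖ ≤ R → inner ℝ x e = 0 → v x = 0)
    (hvc : ∀ x, ‖x‖ = R → inner ℝ x e = 0 → 0 < fderiv ℝ v x e) :
    ∀ x, ‖x‖ ≤ R → 0 < inner ℝ x e → g x ≤ 0 := by
  have hgd := hg.differentiable (by norm_num)
  have hvd := hv.differentiable (by norm_num)
  have hgf : Continuous fun x => fderiv ℝ g x e :=
    (hg.continuous_fderiv (by norm_num)).clm_apply continuous_const
  have hvf : Continuous fun x => fderiv ℝ v x e :=
    (hv.continuous_fderiv (by norm_num)).clm_apply continuous_const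
  have hfw : ∀ (s : ℝ) x, fderiv ℝ (fun y => v y - s * g y) x e =
      fderiv ℝ v x e - s * fderiv ℝ g x e := fun s x => by
    rw [fderiv_fun_sub (hvd x) ((hgd x).const_mul s), sub_apply, fderiv_const_mul (hgd x)]
    simp
  have hwc : ∀ s : ℝ, Continuous fun y => v y - s * g y := fun s =>
    hv.continuous.sub (continuous_const.mul hg.continuous)
  set S : Set (ℝ × EuclideanSpace ℝ (Fin N)) :=
    {q | q.2 ∈ closedBall 0 R ∧ 0 ≤ inner ℝ q.2 e ∧ v q.2 - q.1 * g q.2 ≤ 0 ∧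
      fderiv ℝ v q.2 e - q.1 * fderiv ℝ g q.2 e = 0} with hS
  have hSc : IsClosed S := by
    have c1 : IsClosed {q : ℝ × EuclideanSpace ℝ (Fin N) | 0 ≤ inner ℝ q.2 e} :=
      isClosed_le continuous_const (by fun_prop)
    have c2 : IsClosed {q : ℝ × EuclideanSpace ℝ (Fin N) | v q.2 - q.1 * g q.2 ≤ 0} :=
      isClosed_le ((hv.continuous.comp continuous_snd).sub
        (continuous_fst.mul (hg.continuous.comp continuous_snd))) continuous_const
    have c3 : IsClosed {q : ℝ × EuclideanSpace ℝ (Fin N) |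
        fderiv ℝ v q.2 e - q.1 * fderiv ℝ g q.2 e = 0} :=
      isClosed_eq ((hvf.comp continuous_snd).sub (continuous_fst.mul (hgf.comp continuous_snd)))
        continuous_const
    exact (isClosed_closedBall.preimage continuous_snd).inter (c1.inter (c2.inter c3))
  have hA : IsClosed (Prod.fst '' S) :=
    isClosed_image_fst (isCompact_closedBall 0 R) hSc fun q hq => hq.1
  set P : Set ℝ := {s | ∀ x, ‖x‖ ≤ R → 0 < inner ℝ x e → 0 ≤ v x - s * g x} with hP
  have hPc : IsClosed P := by
    have : P = ⋂ (x : EuclideanSpace ℝ (Fin N)) (_ : ‖x‖ ≤ R) (_ : 0 < inner ℝ x e),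
        {s | 0 ≤ v x - s * g x} := by
      ext t; simp [hP]
    rw [this]
    refine isClosed_iInter fun x => isClosed_iInter fun _ => isClosed_iInter fun _ =>
      isClosed_le continuous_const (by fun_prop)
  have h1 : ∀ s ∈ Ici (0 : ℝ), s ∉ P → s ∈ Prod.fst '' S := by
    intro s hs hsP
    simp only [hP, mem_ofPred_eq, not_forall, not_le] at hsP
    obtain ⟨z, hz1, hz2, hz3⟩ := hsP
    obtain ⟨x, hx1, hx2, hx3, hx4⟩ := exists_critical_of_neg_cap (R := R) (t := 0) (e := e)
      (hwc s) (fun x hx hxt => by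
        rw [hg1 x hx, mul_zero, sub_zero]
        rcases hxt.eq_or_lt with h | h
        · exact (hv0 x hx.le h.symm).ge
        · exact (hvpos x hx.le h).le)
      (fun x hx hxt => by rw [hg2 x hx hxt, hv0 x hx hxt, mul_zero, sub_zero])
      ⟨z, hz1, hz2.le, hz3⟩
    refine ⟨(s, x), ⟨by simpa using hx1.le, hx2.le, hx3.le, ?_⟩, rfl⟩
    have h := DFunLike.congr_fun hx4 e
    rwa [hfw] at h
  have h2 : ∀ s ∈ Ici (0 : ℝ), s ∈ P → s ∉ Prod.fst '' S := by
    rintro s hs hsP ⟨⟨s', x⟩, ⟨hx1, hx2, hx3, hx4⟩, rfl⟩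
    simp only at *
    have hs0 : 0 ≤ s' := hs
    have hx1' : ‖x‖ ≤ R := by simpa using hx1
    have hRe : ‖R • e‖ = R := by rw [norm_smul, he, mul_one, Real.norm_eq_abs, abs_of_pos hR]
    obtain ⟨hA, hB⟩ := pos_of_lapl_nonpos_cap (R := R) (t := 0) hN he (hwc s')
      (fun x hx hxt => (hv2 x hx hxt).sub (contDiffAt_const.mul hg.contDiffAt))
      (fun x hx hxt => by
        rw [lapl_sub (hv2 x hx hxt) (contDiffAt_const.mul hg.contDiffAt),
          lapl_const_mul s' hg.contDiffAt]
        have e1 := hvl x hx hxt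
        have e2 := hgl x hx
        have e3 : 0 ≤ μ * (V x * (v x - s' * g x)) :=
          mul_nonneg hμ (mul_nonneg (hV x) (hsP x hx.le hxt))
        have e4 : 0 ≤ (κ - μ) * (V x * v x) :=
          mul_nonneg (sub_nonneg.2 hμκ) (mul_nonneg (hV x) (hvpos x hx.le hxt).le)
        linear_combination e3 + e4 - e1 + s' * e2)
      (fun x hx hxt => hsP x hx.le hxt)
      (exists_pos_cap he hR hR (hwc s') (by
        rw [hg1 _ hRe, mul_zero, sub_zero]
        exact hvpos _ hRe.le
          (by rw [real_inner_smul_left, real_inner_self_eq_norm_sq, he]; linarith)))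
    rcases hx2.eq_or_lt with h | h
    · rcases hx1'.eq_or_lt with h' | h'
      · have hgx := fderiv_eq_zero_of_tangent (hgd x) hg1 h'
          (by rintro rfl; simp at h'; linarith) h.symm
        rw [hgx] at hx4
        linarith [hvc x h' h.symm]
      · have := hB x h' h.symm (by rw [hg2 x hx1' h.symm, hv0 x hx1' h.symm, mul_zero, sub_zero])
          ((hvd x).sub ((hgd x).const_mul s'))
        rw [hfw] at this
        linarith
    · rcases hx1'.eq_or_lt with h' | h'
      · rw [hg1 x h', mul_zero, sub_zero] at hx3
        exact (hvpos x hx1' h).not_ge hx3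
      · exact (hA x h' h).not_ge hx3
  have h4 : (Ici 0 ∩ P).Nonempty :=
    ⟨0, self_mem_Ici, fun x hx hxe => by rw [zero_mul, sub_zero]; exact (hvpos x hx hxe).le⟩
  have hall := subset_of_closed_dichotomy isPreconnected_Ici hA hPc h1 h2 h4
  intro x hx hxe
  by_contra! hgx
  have h5 := hall (show (v x + 1) / g x ∈ Ici 0 from
    div_nonneg (by linarith [hvpos x hx hxe]) hgx.le) x hx hxe
  rw [div_mul_cancel₀ _ hgx.ne'] at h5
  linarith

end EigenSymmetry

section EigenRadial

variable {N : ℕ} {e : EuclideanSpace ℝ (Fin N)} {R : ℝ} {f : ℝ → ℝ}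
  {ψ : EuclideanSpace ℝ (Fin N) → ℝ}

lemma norm_planeRefl_zero_lt (he : ‖e‖ = 1) {x : EuclideanSpace ℝ (Fin N)} (hx : ‖x‖ < R) :
    ‖planeRefl e 0 x‖ < R := by rwa [norm_planeRefl_zero he]

lemma fderiv_eq_zero_of_orthogonal (hR : 0 < R) (hψ : ContDiff ℝ 2 ψ)
    (h0 : ∀ x, ‖x‖ = R → ψ x = 0) (he : ‖e‖ = 1)
    (hsym : ∀ x, ‖x‖ ≤ R → ψ (planeRefl e 0 x) = ψ x) {x : EuclideanSpace ℝ (Fin N)}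
    (hx : ‖x‖ ≤ R) (hxe : inner ℝ x e = 0) : fderiv ℝ ψ x e = 0 := by
  have hd := hψ.differentiable (by norm_num)
  rcases hx.eq_or_lt with h | h
  · exact fderiv_eq_zero_of_tangent (hd x) h0 h (by rintro rfl; simp at h; linarith) hxe
  · have h1 : (fun y => ψ (planeRefl e 0 y)) =ᶠ[𝓝 x] ψ := by
      filter_upwards [continuous_norm.continuousAt.eventually (gt_mem_nhds h)] with y hy
      exact hsym y hy.le
    have h2 := fderiv_comp_planeRefl he hd 0 x
    rw [h1.fderiv_eq, planeRefl_of_inner_eq hxe] at h2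
    linarith

/-- Eigenfunctions of the linearization are invariant under reflections when the spectral
parameter does not exceed that of the linearized equation. -/
lemma eigen_planeRefl (hN : 0 < N) (hR : 0 < R) (hψ : ContDiff ℝ 2 ψ) (hf : Monotone f)
    (hf0 : ∀ s, 0 ≤ f s) (hf1 : ContDiff ℝ 1 f)
    (hl : ∀ x, ‖x‖ < R → -lapl ψ x = f (ψ x)) (h0 : ∀ x, ‖x‖ = R → ψ x = 0)
    (hpos : ∀ x, ‖x‖ < R → 0 < ψ x) {μ κ c : ℝ} (hμκ : μ ≤ κ)
    {V φ : EuclideanSpace ℝ (Fin N) → ℝ} (hV : ∀ x, 0 ≤ V x)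
    (hVf : ∀ x, deriv f (ψ x) = κ * V x)
    (hVs : ∀ x y, ψ x = ψ y → V x = V y)
    (hφ : ContDiff ℝ 2 φ) (hφ0 : ∀ x, ‖x‖ = R → φ x = 0)
    (hφl : ∀ x, ‖x‖ < R → -lapl φ x = μ * (V x * (φ x - c))) (he : ‖e‖ = 1)
    {x : EuclideanSpace ℝ (Fin N)} (hx : ‖x‖ ≤ R) : φ (planeRefl e 0 x) = φ x := by
  have hsym : ∀ (e : EuclideanSpace ℝ (Fin N)), ‖e‖ = 1 → ∀ x, ‖x‖ ≤ R →
      ψ (planeRefl e 0 x) = ψ x := fun e he x hx =>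
    eq_planeRefl_zero hN hR hψ hf hf0 hl h0 hpos he hx
  have hrad : ∀ x y, ‖x‖ ≤ R → ‖x‖ = ‖y‖ → ψ x = ψ y := fun x y hx hxy =>
    eq_of_norm_eq_of_planeRefl hsym hx hxy
  have hcomp : ContDiff ℝ 2 fun y => φ (planeRefl e 0 y) := hφ.comp (contDiff_planeRefl 0)
  set g : EuclideanSpace ℝ (Fin N) → ℝ := fun y => φ y - φ (planeRefl e 0 y) with hgdef
  have hg : ContDiff ℝ 2 g := hφ.sub hcomp
  have hg1 : ∀ x, ‖x‖ = R → g x = 0 := fun x hx => by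
    simp only [hgdef]; rw [hφ0 x hx, hφ0 _ (by rwa [norm_planeRefl_zero he]), sub_self]
  have hg2 : ∀ x, inner ℝ x e = 0 → g x = 0 := fun x hxe => by
    simp only [hgdef]; rw [planeRefl_of_inner_eq hxe, sub_self]
  have hgo : ∀ x, g (planeRefl e 0 x) = -g x := fun x => by
    simp only [hgdef]; rw [planeRefl_planeRefl he]; ring
  have hgl : ∀ x, ‖x‖ < R → -lapl g x = μ * (V x * g x) := fun x hx => by
    have h1 := hφl x hx
    have h2 := hφl _ (norm_planeRefl_zero_lt he hx)
    rw [hVs _ _ (hsym e he x hx.le)] at h2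
    simp only [hgdef]
    rw [lapl_sub hφ.contDiffAt hcomp.contDiffAt, lapl_comp_planeRefl he hφ]
    linear_combination h1 - h2
  have hng : ContDiff ℝ 2 fun y => -g y := hg.neg
  have hngl : ∀ x, ‖x‖ < R → -lapl (fun y => -g y) x = μ * (V x * -g x) := fun x hx => by
    rw [lapl_neg hg.contDiffAt]; linear_combination -hgl x hx
  suffices hgx : ∀ x, ‖x‖ ≤ R → 0 < inner ℝ x e → g x = 0 by
    have : g x = 0 := by
      rcases lt_trichotomy (inner ℝ x e) 0 with h | h | h
      · have := hgx (planeRefl e 0 x) (by rwa [norm_planeRefl_zero he])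
          (by rw [inner_planeRefl he]; linarith)
        rw [hgo] at this
        linarith
      · exact hg2 x h
      · exact hgx x hx h
    simp only [hgdef] at this
    linarith
  rcases le_or_gt μ 0 with hμ | hμ
  · have key : ∀ w : EuclideanSpace ℝ (Fin N) → ℝ, ContDiff ℝ 2 w → (∀ x, ‖x‖ = R → w x = 0) →
        (∀ x, ‖x‖ < R → -lapl w x = μ * (V x * w x)) → ∀ x, ‖x‖ ≤ R → 0 ≤ w x := by
      intro w hw hw1 hw2 x hx
      rcases hx.eq_or_lt with h | h
      · exact (hw1 x h).ge
      refine nonneg_of_lapl_nonpos hN (isBounded_ball (x := 0) (r := R)) isOpen_ball hw.continuous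
        (fun x _ => hw.contDiffAt) (fun x hx hwx => ?_) (fun x hx => ?_) x (by simpa using h)
      · have h1 := hw2 x (by simpa using hx)
        have h2 : 0 ≤ μ * (V x * w x) := mul_nonneg_of_nonpos_of_nonpos hμ
          (mul_nonpos_of_nonneg_of_nonpos (hV x) hwx.le)
        linarith
      · rw [frontier_ball _ hR.ne'] at hx
        exact (hw1 x (by simpa using hx)).ge
    intro x hx _
    have h1 := key g hg hg1 hgl x hx
    have h2 := key (fun y => -g y) hng (fun x hx => by rw [hg1 x hx, neg_zero]) hngl x hx
    linarith
  · have hfd : ContDiff ℝ 1 fun y => -fderiv ℝ ψ y e :=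
      ((hψ.fderiv_right (m := 1) (by norm_num)).clm_apply contDiff_const).neg
    have hne : ∀ x : EuclideanSpace ℝ (Fin N), 0 < inner ℝ x e → x ≠ 0 := by
      rintro x hx rfl; simp at hx
    have h3 : ∀ x, ‖x‖ < R → 0 < inner ℝ x e → ContDiffAt ℝ 3 ψ x := fun x hx hxe =>
      contDiffAt_three_of_radial hψ hrad he hf1 hl (hne x hxe) hx
    have hfd2 : ∀ x, ‖x‖ < R → 0 < inner ℝ x e → ContDiffAt ℝ 2 (fun y => fderiv ℝ ψ y e) x :=
      fun x hx hxe => ((h3 x hx hxe).fderiv_right (m := 2) (by norm_num)).clm_apply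
        contDiffAt_const
    have hvl : ∀ x, ‖x‖ < R → 0 < inner ℝ x e →
        -lapl (fun y => -fderiv ℝ ψ y e) x = κ * (V x * -fderiv ℝ ψ x e) := fun x hx hxe => by
      rw [lapl_neg (hfd2 x hx hxe), lapl_fderiv_apply (h3 x hx hxe)]
      have h4 : lapl ψ =ᶠ[𝓝 x] fun y => -f (ψ y) := by
        filter_upwards [continuous_norm.continuousAt.eventually (gt_mem_nhds hx)] with y hy
        linarith [hl y hy]
      have h5 : HasFDerivAt (fun y => f (ψ y)) (deriv f (ψ x) • fderiv ℝ ψ x) x :=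
        (hf1.differentiable (by norm_num) (ψ x)).hasDerivAt.comp_hasFDerivAt x
          (hψ.differentiable (by norm_num) x).hasFDerivAt
      rw [h4.fderiv_eq, h5.fun_neg.fderiv, hVf]
      simp
      ring
    have hcap := fun w (hw : ContDiff ℝ 2 w) (hw1 : ∀ x, ‖x‖ = R → w x = 0)
        (hw2 : ∀ x, ‖x‖ ≤ R → inner ℝ x e = 0 → w x = 0)
        (hwl : ∀ x, ‖x‖ < R → -lapl w x = μ * (V x * w x)) =>
      nonpos_of_eigen_cap (v := fun y => -fderiv ℝ ψ y e) hN hR he hμ.le hμκ hV hw hw1 hw2 hwl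
        hfd (fun x hx hxe => (hfd2 x hx hxe).neg) hvl
        (fun x hx hxe => neg_pos.2
          (fderiv_neg_of_inner_pos hN hR hψ hf hf0 hl h0 hpos he hx hxe))
        (fun x hx hxe => by
          rw [fderiv_eq_zero_of_orthogonal hR hψ h0 he (hsym e he) hx hxe, neg_zero])
        (fun x hx hxe => by
          have h6 := fderiv_fderiv_tangent hR hψ h0 he hx hxe
          have h7 : fderiv ℝ ψ x x < 0 := fderiv_neg_of_norm_eq hN hR hψ
            (fun x hx => by linarith [hl x hx, hf0 (ψ x)]) h0 hpos hx
            (by rw [real_inner_self_eq_norm_sq, hx]; positivity)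
          rw [fderiv_fun_neg, neg_apply, neg_pos]
          have h8 : 0 < R ^ 2 := by positivity
          nlinarith)
    intro x hx hxe
    have h1 := hcap g hg hg1 (fun x _ => hg2 x) hgl x hx hxe
    have h2 := hcap (fun y => -g y) hng (fun x hx => by rw [hg1 x hx, neg_zero])
      (fun x _ hx => by rw [hg2 x hx, neg_zero]) hngl x hx hxe
    linarith

end EigenRadial

/-! ### Radial eigenfunctions -/

section RadialODE

variable {R : ℝ}

lemma eq_zero_of_deriv_nonneg_of_tendsto {F F' : ℝ → ℝ} (hF : ∀ r ∈ Ioo 0 R, HasDerivAt F (F' r) r)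
    (hF' : ∀ r ∈ Ioo 0 R, 0 ≤ F' r) (h0 : Tendsto F (𝓝[>] 0) (𝓝 0))
    (hR : Tendsto F (𝓝[<] R) (𝓝 0)) : ∀ r ∈ Ioo 0 R, F' r = 0 := by
  have hmono : MonotoneOn F (Ioo 0 R) := by
    refine monotoneOn_of_deriv_nonneg (convex_Ioo 0 R)
      (fun r hr => (hF r hr).continuousAt.continuousWithinAt) ?_ ?_
    · rw [interior_Ioo]; exact fun r hr => (hF r hr).differentiableAt.differentiableWithinAt
    · rw [interior_Ioo]; intro r hr; rw [(hF r hr).deriv]; exact hF' r hr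
  have hz : ∀ r ∈ Ioo 0 R, F r = 0 := by
    intro r hr
    refine le_antisymm (ge_of_tendsto hR ?_) (le_of_tendsto h0 ?_)
    · filter_upwards [Ioo_mem_nhdsLT hr.2] with s hs
      exact hmono hr ⟨hr.1.trans hs.1, hs.2⟩ hs.1.le
    · filter_upwards [Ioo_mem_nhdsGT hr.1] with s hs
      exact hmono ⟨hs.1, hs.2.trans hr.2⟩ hr hs.2.le
  intro r hr
  refine (hF r hr).unique ((hasDerivAt_const r (0 : ℝ)).congr_of_eventuallyEq ?_)
  filter_upwards [Ioo_mem_nhds hr.1 hr.2] with s hs using hz s hs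

variable {μ κ : ℝ} {W X ζ Z ρ d : ℝ → ℝ}

lemma flux_eq_zero_of_nonpos (hμ : μ ≤ 0) (hd : ∀ r ∈ Ioo 0 R, 0 < d r)
    (hρ : ∀ r ∈ Ioo 0 R, 0 ≤ ρ r) (hW : ∀ r ∈ Ioo 0 R, HasDerivAt W (d r * X r) r)
    (hX : ∀ r ∈ Ioo 0 R, HasDerivAt X (-(μ * (ρ r * W r))) r)
    (h0 : Tendsto (fun r => W r * X r) (𝓝[>] 0) (𝓝 0))
    (hR : Tendsto (fun r => W r * X r) (𝓝[<] R) (𝓝 0)) : ∀ r ∈ Ioo 0 R, X r = 0 := by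
  have h1 : ∀ r ∈ Ioo 0 R, 0 ≤ -μ * (ρ r * W r ^ 2) := fun r hr =>
    mul_nonneg (neg_nonneg.2 hμ) (mul_nonneg (hρ r hr) (sq_nonneg _))
  have h2 : ∀ r ∈ Ioo 0 R, 0 ≤ d r * X r ^ 2 := fun r hr =>
    mul_nonneg (hd r hr).le (sq_nonneg _)
  have h := eq_zero_of_deriv_nonneg_of_tendsto
    (F' := fun r => d r * X r ^ 2 + -μ * (ρ r * W r ^ 2)) (fun r hr => by
      refine ((hW r hr).fun_mul (hX r hr)).congr_deriv ?_
      ring) (fun r hr => add_nonneg (h2 r hr) (h1 r hr)) h0 hR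
  intro r hr
  have h3 : d r * X r ^ 2 = 0 := by linarith [h r hr, h1 r hr, h2 r hr]
  simpa [(hd r hr).ne'] using h3

/-- A Picone-type identity: a radial eigenfunction is compared with the solution `ζ` of the
linearized equation generated by dilations. -/
lemma flux_eq_zero_of_pos (hμ : 0 < μ) (hμκ : μ ≤ κ)
    (hρ : ∀ r ∈ Ioo 0 R, 0 ≤ ρ r) (hZ : ∀ r ∈ Ioo 0 R, Z r < 0)
    (hW : ∀ r ∈ Ioo 0 R, HasDerivAt W (d r * X r) r)
    (hX : ∀ r ∈ Ioo 0 R, HasDerivAt X (-(μ * (ρ r * W r))) r)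
    (hζ : ∀ r ∈ Ioo 0 R, HasDerivAt ζ (d r * Z r) r)
    (hZ' : ∀ r ∈ Ioo 0 R, HasDerivAt Z (-(κ * (ρ r * ζ r))) r)
    (h0 : Tendsto (fun r => X r ^ 2 * ζ r / Z r - W r * X r) (𝓝[>] 0) (𝓝 0))
    (hR : Tendsto (fun r => X r ^ 2 * ζ r / Z r - W r * X r) (𝓝[<] R) (𝓝 0))
    (hR' : Tendsto (fun r => X r / Z r) (𝓝[<] R) (𝓝 0)) : ∀ r ∈ Ioo 0 R, X r = 0 := by
  set q : ℝ → ℝ := fun r => X r * ζ r / Z r with hq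
  have h1 : ∀ r ∈ Ioo 0 R, 0 ≤ ρ r * (μ * (W r - q r) ^ 2) := fun r hr =>
    mul_nonneg (hρ r hr) (mul_nonneg hμ.le (sq_nonneg _))
  have h2 : ∀ r ∈ Ioo 0 R, 0 ≤ ρ r * ((κ - μ) * q r ^ 2) := fun r hr =>
    mul_nonneg (hρ r hr) (mul_nonneg (sub_nonneg.2 hμκ) (sq_nonneg _))
  have h := eq_zero_of_deriv_nonneg_of_tendsto
    (F' := fun r => ρ r * (μ * (W r - q r) ^ 2) + ρ r * ((κ - μ) * q r ^ 2)) (fun r hr => by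
      have hz := (hZ r hr).ne
      refine (((((hX r hr).fun_pow 2).fun_mul (hζ r hr)).fun_div (hZ' r hr) hz).fun_sub
        ((hW r hr).fun_mul (hX r hr))).congr_deriv ?_
      simp only [hq]
      field_simp
      push_cast
      ring) (fun r hr => add_nonneg (h1 r hr) (h2 r hr)) h0 hR
  have hXZ : ∀ r ∈ Ioo 0 R, HasDerivAt (fun r => X r / Z r) 0 r := fun r hr => by
    have hz := (hZ r hr).ne
    refine ((hX r hr).fun_div (hZ' r hr) hz).congr_deriv ?_
    have h3 : ρ r * (μ * (W r - q r) ^ 2) = 0 := by linarith [h r hr, h1 r hr, h2 r hr]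
    have h4 : ρ r * ((κ - μ) * q r ^ 2) = 0 := by linarith [h r hr, h1 r hr, h2 r hr]
    have h5 : ρ r * (W r - q r) = 0 := by
      rcases mul_eq_zero.1 h3 with h3 | h3
      · rw [h3, zero_mul]
      · have : W r - q r = 0 := by simpa [hμ.ne'] using h3
        rw [this, mul_zero]
    have h6 : ρ r * ((κ - μ) * q r) = 0 := by
      rcases mul_eq_zero.1 h4 with h4 | h4
      · rw [h4, zero_mul]
      · have : (κ - μ) * q r = 0 := by
          rcases mul_eq_zero.1 h4 with h4 | h4
          · rw [h4, zero_mul]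
          · rw [pow_eq_zero_iff two_ne_zero] at h4; rw [h4, mul_zero]
        rw [this, mul_zero]
    have h7 : X r * ζ r = q r * Z r := by simp only [hq]; field_simp
    rw [div_eq_zero_iff]
    left
    linear_combination (-(μ * Z r)) * h5 + Z r * h6 + κ * ρ r * h7
  intro r hr
  have hconst : ∀ s ∈ Ioo 0 R, X s / Z s = X r / Z r := fun s hs =>
    (convex_Ioo 0 R).is_const_of_fderivWithin_eq_zero (𝕜 := ℝ) (f := fun r => X r / Z r)
      (fun t ht => (hXZ t ht).differentiableAt.differentiableWithinAt) (fun t ht => by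
        rw [fderivWithin_eq_fderiv (isOpen_Ioo.uniqueDiffWithinAt ht) (hXZ t ht).differentiableAt]
        ext; simp [(hXZ t ht).deriv]) hs hr
  have hlim : Tendsto (fun s => X s / Z s) (𝓝[<] R) (𝓝 (X r / Z r)) :=
    tendsto_const_nhds.congr' (by
      filter_upwards [Ioo_mem_nhdsLT (hr.1.trans hr.2)] with s hs using (hconst s hs).symm)
  have h8 := tendsto_nhds_unique hlim hR'
  exact (div_eq_zero_iff.1 h8).resolve_right (hZ r hr).ne

end RadialODE

section RadialEigen

variable {R : ℝ} {n : ℕ}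

lemma hasDerivAt_flux {y' : ℝ → ℝ} {a r : ℝ} (hr : 0 < r)
    (hy : HasDerivAt y' (-a - n * (y' r / r)) r) :
    HasDerivAt (fun r => r ^ n * y' r) (-(r ^ n * a)) r := by
  refine ((hasDerivAt_pow n r).fun_mul hy).congr_deriv ?_
  rcases n with _ | n
  · simp
  · rw [Nat.add_sub_cancel]
    push_cast
    field_simp
    ring

lemma max_rpow_mul {p : ℝ} (hp : 1 < p) (s : ℝ) : (max s 0) ^ (p - 1) * s = (max s 0) ^ p := by
  rcases le_or_gt s 0 with hs | hs
  · rw [max_eq_right hs, Real.zero_rpow (by linarith), Real.zero_rpow (by linarith), zero_mul]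
  · rw [max_eq_left hs.le]
    nth_rw 2 [← Real.rpow_one s]
    rw [← Real.rpow_add hs, sub_add_cancel]

lemma tendsto_nhdsLT_of_continuousAt {F : ℝ → ℝ} {a b : ℝ} (h : ContinuousAt F a) (hb : F a = b) :
    Tendsto F (𝓝[<] a) (𝓝 b) := hb ▸ h.tendsto.mono_left nhdsWithin_le_nhds

lemma tendsto_nhdsGT_of_continuousAt {F : ℝ → ℝ} {a b : ℝ} (h : ContinuousAt F a) (hb : F a = b) :
    Tendsto F (𝓝[>] a) (𝓝 b) := hb ▸ h.tendsto.mono_left nhdsWithin_le_nhds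

variable {p lam μ : ℝ} {U U' W W' : ℝ → ℝ}

lemma radial_eigen_const_of_nonpos (hn : n ≠ 0) (hμ : μ ≤ 0) {v : ℝ → ℝ} (hv : ∀ r, 0 ≤ v r)
    (hW : ∀ r, HasDerivAt W (W' r) r) (hW' : Continuous W')
    (hode : ∀ r ∈ Ioo 0 R, HasDerivAt W' (-(μ * (v r * W r)) - n * (W' r / r)) r)
    (hWR : W' R = 0) : ∀ r ∈ Ioo 0 R, W' r = 0 := by
  have hWc : Continuous W := continuous_iff_continuousAt.2 fun r => (hW r).continuousAt
  have h := flux_eq_zero_of_nonpos (R := R) (W := W) (X := fun r => r ^ n * W' r)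
    (ρ := fun r => r ^ n * v r) (d := fun r => (r ^ n)⁻¹) hμ
    (fun r hr => by have := hr.1; positivity)
    (fun r hr => mul_nonneg (pow_nonneg hr.1.le _) (hv r))
    (fun r hr => by
      rw [inv_mul_cancel_left₀ (pow_ne_zero _ hr.1.ne')]; exact hW r)
    (fun r hr => (hasDerivAt_flux hr.1 (hode r hr)).congr_deriv (by ring))
    (tendsto_nhdsGT_of_continuousAt (by fun_prop) (by simp [hn]))
    (tendsto_nhdsLT_of_continuousAt (by fun_prop) (by simp [hWR]))
  intro r hr
  exact (mul_eq_zero.1 (h r hr)).resolve_left (pow_ne_zero _ hr.1.ne')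

lemma radial_eigen_const_of_pos (hn : n ≠ 0) (hR : 0 < R) (hp : 1 < p) (hlam : 0 < lam)
    (hnp : (n + 1 : ℝ) < 2 * p / (p - 1)) (hμ : 0 < μ) (hμp : μ ≤ p * lam)
    (hU : ∀ r, HasDerivAt U (U' r) r) (hU' : Continuous U')
    (hUode : ∀ r ∈ Ioo 0 R, HasDerivAt U' (-(lam * (max (U r) 0) ^ p) - n * (U' r / r)) r)
    (hUneg : ∀ r, 0 < r → r ≤ R → U' r < 0) (hU0 : 0 < U 0)
    (hW : ∀ r, HasDerivAt W (W' r) r) (hW' : Continuous W')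
    (hode : ∀ r ∈ Ioo 0 R,
      HasDerivAt W' (-(μ * ((max (U r) 0) ^ (p - 1) * W r)) - n * (W' r / r)) r)
    (hW0 : W' 0 = 0) (hWR : W' R = 0) : ∀ r ∈ Ioo 0 R, W' r = 0 := by
  have hWc : Continuous W := continuous_iff_continuousAt.2 fun r => (hW r).continuousAt
  have hUc : Continuous U := continuous_iff_continuousAt.2 fun r => (hU r).continuousAt
  have hUp : Continuous fun r => (max (U r) 0) ^ p :=
    (hUc.max continuous_const).rpow_const fun _ => Or.inr (by linarith)
  have hp1 : p - 1 ≠ 0 := by linarith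
  set c : ℝ := 2 * p / (p - 1) - (n + 1) with hc
  have hc0 : 0 < c := sub_pos.2 hnp
  set ζ : ℝ → ℝ := fun r => r * U' r + 2 / (p - 1) * U r with hζ
  set Z : ℝ → ℝ := fun r => -(lam * (r ^ (n + 1) * (max (U r) 0) ^ p)) + c * (r ^ n * U' r) with hZ
  have hζc : Continuous ζ := by fun_prop
  have hZc : Continuous Z := by fun_prop
  have hmax : ∀ r, 0 ≤ (max (U r) 0) ^ p := fun r => Real.rpow_nonneg (le_max_right _ _) _
  have hZle : ∀ r, 0 < r → r ≤ R → Z r < -(lam * (r ^ (n + 1) * (max (U r) 0) ^ p)) :=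
    fun r h1 h2 => by
      have : c * (r ^ n * U' r) < 0 :=
        mul_neg_of_pos_of_neg hc0 (mul_neg_of_pos_of_neg (by positivity) (hUneg r h1 h2))
      simp only [hZ]; linarith
  have hZneg : ∀ r, 0 < r → r ≤ R → Z r < 0 := fun r h1 h2 => by
    have h3 : 0 ≤ lam * (r ^ (n + 1) * (max (U r) 0) ^ p) :=
      mul_nonneg hlam.le (mul_nonneg (by positivity) (hmax r))
    linarith [hZle r h1 h2]
  have hXc : Continuous fun r => r ^ n * W' r := by fun_prop
  have h := flux_eq_zero_of_pos (R := R) (W := W) (X := fun r => r ^ n * W' r) (ζ := ζ) (Z := Z)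
    (ρ := fun r => r ^ n * (max (U r) 0) ^ (p - 1)) (d := fun r => (r ^ n)⁻¹) (κ := p * lam) hμ hμp
    (fun r hr => mul_nonneg (pow_nonneg hr.1.le _) (Real.rpow_nonneg (le_max_right _ _) _))
    (fun r hr => hZneg r hr.1 hr.2.le)
    (fun r hr => by
      rw [inv_mul_cancel_left₀ (pow_ne_zero _ hr.1.ne')]; exact hW r)
    (fun r hr => (hasDerivAt_flux hr.1 (hode r hr)).congr_deriv (by ring))
    (fun r hr => by
      have hr0 := hr.1.ne'
      refine (((hasDerivAt_id r).fun_mul (hUode r hr)).fun_add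
        ((hU r).const_mul (2 / (p - 1)))).congr_deriv ?_
      simp only [hZ, hc, id]
      field_simp
      ring)
    (fun r hr => by
      have h1 : HasDerivAt (fun r => (max (U r) 0) ^ p)
          (p * (max (U r) 0) ^ (p - 1) * U' r) r := (hasDerivAt_max_rpow hp (U r)).comp r (hU r)
      have h2 := hasDerivAt_flux hr.1 (hUode r hr)
      refine ((((hasDerivAt_pow (n + 1) r).fun_mul h1).const_mul lam).fun_neg.fun_add
        (h2.const_mul c)).congr_deriv ?_
      simp only [hζ, hc]
      rw [Nat.add_sub_cancel, ← max_rpow_mul hp]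
      push_cast
      field_simp
      ring)
    ?_ ?_ ?_
  · intro r hr
    exact (mul_eq_zero.1 (h r hr)).resolve_left (pow_ne_zero _ hr.1.ne')
  · have h2 : Tendsto (fun r => W r * (r ^ n * W' r)) (𝓝[>] 0) (𝓝 0) :=
      tendsto_nhdsGT_of_continuousAt (by fun_prop) (by simp [hn])
    have h3 : Tendsto (fun r => r ^ (n - 1) * W' r ^ 2 * |ζ r| / (lam * (max (U r) 0) ^ p)) (𝓝[>] 0)
        (𝓝 0) := by
      refine tendsto_nhdsGT_of_continuousAt (ContinuousAt.div (by fun_prop)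
        (continuous_const.mul hUp).continuousAt ?_) (by simp [hW0])
      rw [max_eq_left hU0.le]
      positivity
    have h4 : Tendsto (fun r => (r ^ n * W' r) ^ 2 * ζ r / Z r) (𝓝[>] 0) (𝓝 0) := by
      refine squeeze_zero_norm' ?_ h3
      filter_upwards [Ioo_mem_nhdsGT hR,
        nhdsWithin_le_nhds (hUc.continuousAt.eventually (lt_mem_nhds hU0))] with r hr hUr
      have hr0 := hr.1
      have h5 : 0 < (max (U r) 0) ^ p := by rw [max_eq_left hUr.le]; positivity
      have h6 := hZle r hr.1 hr.2.le
      have h7 := hZneg r hr.1 hr.2.le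
      rw [Real.norm_eq_abs, abs_div, abs_mul, abs_of_nonneg (sq_nonneg _), abs_of_neg h7,
        div_le_div_iff₀ (by linarith) (by positivity)]
      obtain ⟨m, rfl⟩ : ∃ m, n = m + 1 := Nat.exists_eq_succ_of_ne_zero hn
      rw [Nat.add_sub_cancel]
      have h8 : 0 ≤ r ^ m * W' r ^ 2 * |ζ r| := by positivity
      have h9 : lam * (r ^ (m + 1 + 1) * (max (U r) 0) ^ p) ≤ -Z r := by linarith
      calc (r ^ (m + 1) * W' r) ^ 2 * |ζ r| * (lam * (max (U r) 0) ^ p)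
          = r ^ m * W' r ^ 2 * |ζ r| * (lam * (r ^ (m + 1 + 1) * (max (U r) 0) ^ p)) := by ring
        _ ≤ _ := mul_le_mul_of_nonneg_left h9 h8
    simpa using h4.sub h2
  · refine tendsto_nhdsLT_of_continuousAt (ContinuousAt.sub (ContinuousAt.div (by fun_prop)
      (by fun_prop) (hZneg R hR le_rfl).ne) (by fun_prop)) (by simp [hWR])
  · exact tendsto_nhdsLT_of_continuousAt (ContinuousAt.div (by fun_prop)
      (by fun_prop) (hZneg R hR le_rfl).ne) (by simp [hWR])

end RadialEigen

section Assembly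

lemma RN_pos {N : ℕ} : 0 < RN N := by
  refine Real.rpow_pos_of_pos (ENNReal.toReal_pos ?_ ?_) _
  · exact (measure_ball_pos volume _ one_pos).ne'
  · exact measure_ball_lt_top.ne

lemma intervalIntegral_eq_zero_of_radial {n : ℕ} {R : ℝ} (hR : 0 < R) {F : ℝ → ℝ}
    (h : ∫ x in ball (0 : EuclideanSpace ℝ (Fin (n + 1))) R, F ‖x‖ = 0) :
    ∫ r in (0)..R, r ^ n * F r = 0 := by
  have h1 : ∫ x : EuclideanSpace ℝ (Fin (n + 1)), (Iio R).indicator F ‖x‖ = 0 := by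
    rw [← h, ← integral_indicator measurableSet_ball]
    congr 1 with x
    simp [indicator]
  rw [integral_fun_norm_addHaar volume] at h1
  simp only [finrank_euclideanSpace, Fintype.card_fin, Nat.add_sub_cancel, smul_eq_mul,
    nsmul_eq_mul, mul_eq_zero] at h1
  have hv : volume.real (ball (0 : EuclideanSpace ℝ (Fin (n + 1))) 1) ≠ 0 :=
    (ENNReal.toReal_pos (measure_ball_pos volume _ one_pos).ne' measure_ball_lt_top.ne).ne'
  have h2 := (h1.resolve_left (by positivity)).resolve_left hv
  refine Eq.trans ?_ h2
  rw [intervalIntegral.integral_of_le hR.le, integral_Ioc_eq_integral_Ioo, ← Ioi_inter_Iio,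
    ← setIntegral_indicator measurableSet_Iio]
  refine integral_congr_ae (Eventually.of_forall fun r => ?_)
  simp [indicator]

variable {N : ℕ} {R p lam α : ℝ} {ψ : EuclideanSpace ℝ (Fin N) → ℝ}

lemma monotone_max_rpow (hp : 0 ≤ p) (hlam : 0 ≤ lam) :
    Monotone fun s : ℝ => (max (α + lam * s) 0) ^ p := fun _ _ hab =>
  Real.rpow_le_rpow (le_max_right _ _)
    (max_le_max (add_le_add_right (mul_le_mul_of_nonneg_left hab hlam) α) le_rfl) hp

lemma hasDerivAt_max_affine_rpow (hp : 1 < p) (s : ℝ) :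
    HasDerivAt (fun s : ℝ => (max (α + lam * s) 0) ^ p)
      (p * lam * (max (α + lam * s) 0) ^ (p - 1)) s := by
  have h1 : HasDerivAt (fun s : ℝ => α + lam * s) lam s := by
    simpa using ((hasDerivAt_id s).const_mul lam).const_add α
  have h2 := (hasDerivAt_max_rpow hp (α + lam * s)).comp s h1
  exact h2.congr_deriv (mul_right_comm _ _ _)

lemma contDiff_max_affine_rpow (hp : 1 < p) :
    ContDiff ℝ 1 fun s : ℝ => (max (α + lam * s) 0) ^ p := by
  rw [contDiff_one_iff_deriv]
  refine ⟨fun s => (hasDerivAt_max_affine_rpow hp s).differentiableAt, ?_⟩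
  rw [show deriv (fun s : ℝ => (max (α + lam * s) 0) ^ p) =
    fun s => p * lam * (max (α + lam * s) 0) ^ (p - 1) from
    funext fun s => (hasDerivAt_max_affine_rpow hp s).deriv]
  exact continuous_const.mul (((by fun_prop : Continuous fun s : ℝ => α + lam * s).max
    continuous_const).rpow_const fun _ => Or.inr (by linarith))

lemma continuous_Vfun (hp : 1 < p) (hψ : Continuous ψ) : Continuous (Vfun p lam α ψ) :=
  ((continuous_const.add (continuous_const.mul hψ)).max continuous_const).rpow_const
    fun _ => Or.inr (by linarith)

lemma Vfun_nonneg (x : EuclideanSpace ℝ (Fin N)) : 0 ≤ Vfun p lam α ψ x :=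
  Real.rpow_nonneg (le_max_right _ _) _

lemma integrableOn_ball_of_continuous {g : EuclideanSpace ℝ (Fin N) → ℝ} (hg : Continuous g) :
    IntegrableOn g (ball 0 R) :=
  (hg.continuousOn.integrableOn_compact (isCompact_closedBall 0 R)).mono_set ball_subset_closedBall

lemma mV_ne_zero (hp : 1 < p) (hψ : Continuous ψ)
    (h1 : (∫ x in ball 0 R, (max (α + lam * ψ x) 0) ^ p) = 1) :
    mV (ball 0 R) p lam α ψ ≠ 0 := by
  intro h
  rw [mV, setIntegral_eq_zero_iff_of_nonneg_ae (Eventually.of_forall fun x => Vfun_nonneg x)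
    (integrableOn_ball_of_continuous (continuous_Vfun hp hψ))] at h
  have h2 : (∫ x in ball 0 R, (max (α + lam * ψ x) 0) ^ p) = 0 := by
    refine integral_eq_zero_of_ae ?_
    filter_upwards [h] with x hx
    rw [← max_rpow_mul hp]
    exact mul_eq_zero_of_left hx _
  exact one_ne_zero (h1.symm.trans h2)

lemma integral_Vfun_mul_sub_avgV (hp : 1 < p) (hψ : Continuous ψ)
    {φ : EuclideanSpace ℝ (Fin N) → ℝ} (hφ : Continuous φ)
    (h1 : (∫ x in ball 0 R, (max (α + lam * ψ x) 0) ^ p) = 1) :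
    ∫ x in ball 0 R, Vfun p lam α ψ x * (φ x - avgV (ball 0 R) p lam α ψ φ) = 0 := by
  have hV := continuous_Vfun (lam := lam) (α := α) hp hψ
  simp only [mul_sub]
  rw [integral_sub (integrableOn_ball_of_continuous (hV.fun_mul hφ))
    (integrableOn_ball_of_continuous (hV.fun_mul continuous_const)), integral_mul_const, avgV, ← mV,
    mul_div_cancel₀ _ (mV_ne_zero hp hψ h1), sub_self]

lemma pos_of_sol (hN : 0 < N) (hR : 0 < R) (hψ : ContDiff ℝ 2 ψ)
    (hl : ∀ x, ‖x‖ < R → -lapl ψ x = (max (α + lam * ψ x) 0) ^ p)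
    (h0 : ∀ x, ‖x‖ = R → ψ x = 0)
    (h1 : (∫ x in ball 0 R, (max (α + lam * ψ x) 0) ^ p) = 1) :
    ∀ x, ‖x‖ < R → 0 < ψ x := by
  have hle : ∀ x ∈ ball (0 : EuclideanSpace ℝ (Fin N)) R, lapl ψ x ≤ 0 := fun x hx => by
    have h2 := hl x (by simpa using hx)
    have h3 : 0 ≤ (max (α + lam * ψ x) 0) ^ p := Real.rpow_nonneg (le_max_right _ _) _
    linarith
  have hnn : ∀ x ∈ ball (0 : EuclideanSpace ℝ (Fin N)) R, 0 ≤ ψ x :=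
    nonneg_of_lapl_nonpos hN isBounded_ball isOpen_ball hψ.continuous (fun x _ => hψ.contDiffAt)
      (fun x hx _ => hle x hx) fun x hx => by
        rw [frontier_ball _ hR.ne'] at hx
        exact (h0 x (by simpa using hx)).ge
  have hex : ∃ x ∈ ball (0 : EuclideanSpace ℝ (Fin N)) R, 0 < ψ x := by
    by_contra! hcon
    have hz : ∀ x ∈ ball (0 : EuclideanSpace ℝ (Fin N)) R, (max (α + lam * ψ x) 0) ^ p = 0 := by
      intro x hx
      have h2 : ψ =ᶠ[𝓝 x] fun _ => 0 := by
        filter_upwards [isOpen_ball.mem_nhds hx] with y hy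
        exact le_antisymm (hcon y hy) (hnn y hy)
      rw [← hl x (by simpa using hx), lapl_congr h2]
      simp [lapl]
    rw [setIntegral_congr_fun measurableSet_ball hz] at h1
    simp at h1
  intro x hx
  exact pos_of_lapl_nonpos hN isOpen_ball (convex_ball _ _).isPreconnected hψ.continuous
    (fun x _ => hψ.contDiffAt) hle hnn hex x (by simpa using hx)

end Assembly

section Main

lemma eigenfunction_eq_zero {n : ℕ} {R p lam α μ : ℝ}
    {ψ φ : EuclideanSpace ℝ (Fin (n + 1)) → ℝ} (hn : n ≠ 0) (hR : 0 < R) (hp : 1 < p)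
    (hnp : (n + 1 : ℝ) < 2 * p / (p - 1)) (hlam : 0 ≤ lam) (hμ : μ ≤ p * lam)
    (hψ : ContDiff ℝ 2 ψ)
    (hl : ∀ x, ‖x‖ < R → -lapl ψ x = (max (α + lam * ψ x) 0) ^ p)
    (h0 : ∀ x, ‖x‖ = R → ψ x = 0)
    (h1 : (∫ x in ball 0 R, (max (α + lam * ψ x) 0) ^ p) = 1)
    (hφ : ContDiff ℝ 2 φ) (hφ0 : ∀ x, ‖x‖ = R → φ x = 0)
    (hφl : ∀ x, ‖x‖ < R → -lapl φ x =
      μ * (Vfun p lam α ψ x * (φ x - avgV (ball 0 R) p lam α ψ φ))) :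
    ∀ x, ‖x‖ ≤ R → φ x = 0 := by
  set c := avgV (ball 0 R) p lam α ψ φ with hc
  set V := Vfun p lam α ψ with hV
  have hf : Monotone fun s : ℝ => (max (α + lam * s) 0) ^ p := monotone_max_rpow (by linarith) hlam
  have hf0 : ∀ s : ℝ, 0 ≤ (max (α + lam * s) 0) ^ p := fun s =>
    Real.rpow_nonneg (le_max_right _ _) _
  have hpos := pos_of_sol n.succ_pos hR hψ hl h0 h1
  have hψr : ∀ x y, ‖x‖ ≤ R → ‖x‖ = ‖y‖ → ψ x = ψ y := fun x y hx hxy =>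
    eq_of_norm_eq_of_planeRefl (fun e he x hx =>
      eq_planeRefl_zero n.succ_pos hR hψ hf hf0 hl h0 hpos he hx) hx hxy
  have hφr : ∀ x y, ‖x‖ ≤ R → ‖x‖ = ‖y‖ → φ x = φ y := fun x y hx hxy =>
    eq_of_norm_eq_of_planeRefl (fun e he x hx =>
      eigen_planeRefl n.succ_pos hR hψ hf hf0 (contDiff_max_affine_rpow hp) hl h0 hpos hμ
        (fun x => Vfun_nonneg x) (fun x => (hasDerivAt_max_affine_rpow hp (ψ x)).deriv)
        (fun x y hxy => by simp only [Vfun, hxy]) hφ hφ0 hφl he hx) hx hxy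
  obtain ⟨e, he⟩ : ∃ e : EuclideanSpace ℝ (Fin (n + 1)), ‖e‖ = 1 :=
    ⟨EuclideanSpace.single 0 1, by simp⟩
  have hre : ∀ r : ℝ, 0 ≤ r → ‖r • e‖ = r := fun r hr => by
    rw [norm_smul, he, mul_one, Real.norm_eq_abs, abs_of_nonneg hr]
  set W' : ℝ → ℝ := deriv fun r : ℝ => φ (r • e) with hW'def
  have hφd : ∀ r, HasDerivAt (fun r : ℝ => φ (r • e)) (W' r) r := fun r =>
    ((contDiff_profile hφ).differentiable (by norm_num) r).hasDerivAt
  have hψd : ∀ r, HasDerivAt (fun r : ℝ => ψ (r • e)) (deriv (fun r : ℝ => ψ (r • e)) r) r :=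
    fun r => ((contDiff_profile hψ).differentiable (by norm_num) r).hasDerivAt
  have hC1 : ∀ g : EuclideanSpace ℝ (Fin (n + 1)) → ℝ, ContDiff ℝ 2 g →
      ContDiff ℝ 1 (deriv fun r : ℝ => g (r • e)) := fun g hg =>
    (contDiff_succ_iff_deriv.1 (show ContDiff ℝ (1 + 1) _ by
      simpa [one_add_one_eq_two] using contDiff_profile hg)).2.2
  have hW : ∀ r, HasDerivAt (fun r : ℝ => φ (r • e) - c) (W' r) r := fun r => (hφd r).sub_const c
  have hW' : Continuous W' := (hC1 φ hφ).continuous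
  have hWode : ∀ r ∈ Ioo 0 R,
      HasDerivAt W' (-(μ * (V (r • e) * (φ (r • e) - c))) - n * (W' r / r)) r := fun r hr => by
    have h2 := ((hC1 φ hφ).differentiable (by norm_num) r).hasDerivAt
    rw [profile_ode hφ hφr he hφl hr] at h2
    simpa using h2
  have hW0 : W' 0 = 0 := deriv_profile_zero hR hφ hφr he
  have hVc : Continuous V := continuous_Vfun hp hψ.continuous
  have hflux : Continuous fun r : ℝ => r ^ n * (V (r • e) * (φ (r • e) - c)) :=
    (continuous_pow n).mul ((hVc.comp (continuous_id.smul continuous_const)).mul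
      ((hφ.continuous.comp (continuous_id.smul continuous_const)).sub continuous_const))
  have hint : ∫ r in (0)..R, r ^ n * (V (r • e) * (φ (r • e) - c)) = 0 := by
    refine intervalIntegral_eq_zero_of_radial (F := fun r => V (r • e) * (φ (r • e) - c)) hR ?_
    rw [← integral_Vfun_mul_sub_avgV hp hψ.continuous hφ.continuous h1]
    refine setIntegral_congr_fun measurableSet_ball fun x hx => ?_
    have hx' : ‖x‖ ≤ R := (mem_ball_zero_iff.1 hx).le
    simp only [hV, Vfun]
    rw [← eq_profile hφr he hx', ← eq_profile hψr he hx']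
  have hWR : W' R = 0 := by
    have h2 := intervalIntegral.integral_eq_sub_of_hasDerivAt_of_le hR.le
      (f := fun r => r ^ n * W' r) (f' := fun r => -(μ * (r ^ n * (V (r • e) * (φ (r • e) - c)))))
      (by fun_prop) (fun r hr => (hasDerivAt_flux hr.1 (hWode r hr)).congr_deriv (by ring))
      ((continuous_const.mul hflux).neg.intervalIntegrable _ _)
    rw [intervalIntegral.integral_neg, intervalIntegral.integral_const_mul, hint, hW0] at h2
    simpa [hR.ne'] using h2.symm
  have hconst : ∀ r ∈ Ioo 0 R, W' r = 0 := by
    rcases le_or_gt μ 0 with hμ0 | hμ0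
    · exact radial_eigen_const_of_nonpos hn hμ0 (fun r => Vfun_nonneg _) hW hW' hWode hWR
    · have hlam0 : 0 < lam := hlam.lt_of_ne (by rintro rfl; linarith)
      have hψ' : ∀ r, 0 < r → r ≤ R → deriv (fun r : ℝ => ψ (r • e)) r < 0 := fun r hr hrR => by
        rw [(hasDerivAt_profile hψ r).deriv]
        exact fderiv_neg_of_inner_pos n.succ_pos hR hψ hf hf0 hl h0 hpos he
          (by rwa [hre r hr.le]) (by rwa [real_inner_smul_left, real_inner_self_eq_norm_sq, he,
            one_pow, mul_one])
      have hanti : AntitoneOn (fun r : ℝ => ψ (r • e)) (Icc 0 R) := by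
        refine antitoneOn_of_deriv_nonpos (convex_Icc 0 R)
          (contDiff_profile hψ).continuous.continuousOn
          (fun r _ => (hψd r).differentiableAt.differentiableWithinAt) fun r hr => ?_
        rw [interior_Icc] at hr
        exact (hψ' r hr.1 hr.2.le).le
      have hU0 : 0 < α + lam * ψ ((0 : ℝ) • e) := by
        by_contra! hle
        have hz : ∀ x ∈ ball (0 : EuclideanSpace ℝ (Fin (n + 1))) R,
            (max (α + lam * ψ x) 0) ^ p = 0 := fun x hx => by
          have hx' : ‖x‖ ≤ R := (mem_ball_zero_iff.1 hx).le
          have h3 : ψ x ≤ ψ ((0 : ℝ) • e) := by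
            rw [eq_profile hψr he hx']
            exact hanti ⟨le_rfl, hR.le⟩ ⟨norm_nonneg x, hx'⟩ (norm_nonneg x)
          have h4 := mul_le_mul_of_nonneg_left h3 hlam
          rw [max_eq_right (by linarith), Real.zero_rpow (by linarith)]
        rw [setIntegral_congr_fun measurableSet_ball hz] at h1
        simp at h1
      refine radial_eigen_const_of_pos (U := fun r => α + lam * ψ (r • e))
        (U' := fun r => lam * deriv (fun r : ℝ => ψ (r • e)) r) hn hR hp hlam0 hnp hμ0 hμ
        (fun r => ((hψd r).const_mul lam).const_add α)
        (continuous_const.mul (hC1 ψ hψ).continuous) (fun r hr => ?_)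
        (fun r h2 h3 => mul_neg_of_pos_of_neg hlam0 (hψ' r h2 h3)) hU0 hW hW' hWode hW0 hWR
      have h2 := ((hC1 ψ hψ).differentiable (by norm_num) r).hasDerivAt
      rw [profile_ode hψ hψr he hl hr] at h2
      refine (h2.const_mul lam).congr_deriv ?_
      push_cast
      ring
  intro x hx
  rw [eq_profile hφr he hx, ← hφ0 (R • e) (hre R hR.le)]
  have h2 : ∀ r ∈ Icc 0 R, φ (r • e) = φ ((0 : ℝ) • e) := by
    refine constant_of_has_deriv_right_zero (contDiff_profile hφ).continuous.continuousOn
      fun r hr => ?_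
    have h3 : W' r = 0 := by
      rcases hr.1.eq_or_lt with h | h
      · rw [← h, hW0]
      · exact hconst r ⟨h, hr.2⟩
    exact h3 ▸ (hφd r).hasDerivWithinAt
  rw [h2 _ ⟨norm_nonneg x, hx⟩, h2 _ ⟨hR.le, le_rfl⟩]

lemma lt_two_mul_div_of_subcritical {N : ℕ} {p : ℝ} (hN : 2 ≤ N) (hp : 1 < p)
    (hpN : N = 2 ∨ p < (N : ℝ) / ((N : ℝ) - 2)) : (N : ℝ) < 2 * p / (p - 1) := by
  rw [lt_div_iff₀ (by linarith)]
  rcases hN.eq_or_lt with rfl | h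
  · push_cast; linarith
  · have h3 : (2 : ℝ) < N := by exact_mod_cast h
    have h4 := (lt_div_iff₀ (by linarith)).1 (hpN.resolve_left h.ne')
    linarith

end Main

theorem stmt0 (N : ℕ) (hN : 2 ≤ N) (p : ℝ) (hp1 : 1 < p)
    (hpN : N = 2 ∨ p < (N : ℝ) / ((N : ℝ) - 2))
    (lam : ℝ) (hlam : 0 ≤ lam) (α : ℝ) (ψ : EuclideanSpace ℝ (Fin N) → ℝ)
    (hsol : IsSol (DN N) p lam α ψ)
    (σ : ℝ) (hσ : IsEigen (DN N) p lam α ψ σ) :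
    0 < σ := by
  by_contra! hσ0
  obtain ⟨n, rfl⟩ : ∃ n, N = n + 1 := ⟨N - 1, by omega⟩
  have hR : 0 < RN (n + 1) := RN_pos
  have hnp := lt_two_mul_div_of_subcritical hN hp1 hpN
  obtain ⟨hψ, hl, h0, h1⟩ := hsol
  obtain ⟨φ, hφ, ⟨x, hx, hφx⟩, hφ0, hφl⟩ := hσ
  have hfr : frontier (DN (n + 1)) = sphere 0 (RN (n + 1)) := frontier_ball _ hR.ne'
  rw [hfr] at h0 hφ0
  rw [DN, closure_ball _ hR.ne', mem_closedBall_zero_iff] at hx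
  exact hφx (eigenfunction_eq_zero (by omega) hR hp1 (by exact_mod_cast hnp) hlam
    (by linarith) hψ (fun y hy => hl y (mem_ball_zero_iff.2 hy))
    (fun y hy => h0 y (mem_sphere_zero_iff_norm.2 hy)) h1 hφ
    (fun y hy => hφ0 y (mem_sphere_zero_iff_norm.2 hy))
    (fun y hy => hφl y (mem_ball_zero_iff.2 hy)) x hx)

end
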